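/- arXiv:math/0305029 — 3 statements merged into one kernel-verified Lean document; each statement's English description precedes it below -/
import Mathlib

section
/- Every finite sequence of integers is equivalent to exactly one canonical sequence: for every X ∈ ℤ* there exists a canonical sequence C with X ~ C, and if C, C' are canonical sequences with C ~ C', then C = C'. -/
/-- `Y` is a blowing-up of the finite integer sequence `X`. -/
inductive SeqBlowup : List ℤ → List ℤ → Prop
  | empty : SeqBlowup [] [-1]
  | left (x : ℤ) (l : List ℤ) : SeqBlowup (x :: l) (-1 :: (x - 1) :: l)
  | mid (A B : List ℤ) (a b : ℤ) :
      SeqBlowup (A ++ a :: b :: B) (A ++ (a - 1) :: -1 :: (b - 1) :: B)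
  | right (l : List ℤ) (x : ℤ) : SeqBlowup (l ++ [x]) (l ++ [x - 1, -1])

/-- Two sequences are equivalent if one is obtained from the other by a finite
sequence of blowings-up and blowings-down. -/
def SeqEquiv (X Y : List ℤ) : Prop := Relation.EqvGen SeqBlowup X Y

/-- A sequence is admissible if every term is `< -1`. -/
def IsAdmissible (A : List ℤ) : Prop := ∀ a ∈ A, a < -1

/-- A canonical sequence: `(0^r, A)` with `A` admissible and `r` even if `A ≠ ∅`. -/
def IsCanonicalSeq (C : List ℤ) : Prop :=
  ∃ (r : ℕ) (A : List ℤ), IsAdmissible A ∧ (A ≠ [] → Even r) ∧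
    C = List.replicate r 0 ++ A

namespace SeqEquiv

theorem symm {X Y : List ℤ} (h : SeqEquiv X Y) : SeqEquiv Y X := Relation.EqvGen.symm _ _ h

theorem trans {X Y Z : List ℤ} (h : SeqEquiv X Y) (h' : SeqEquiv Y Z) : SeqEquiv X Z :=
  Relation.EqvGen.trans _ _ _ h h'

theorem refl (X : List ℤ) : SeqEquiv X X := Relation.EqvGen.refl _

theorem of_blowup {X Y : List ℤ} (h : SeqBlowup X Y) : SeqEquiv X Y := Relation.EqvGen.rel _ _ h

theorem left (x : ℤ) (l : List ℤ) : SeqEquiv (x :: l) (-1 :: (x - 1) :: l) :=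
  of_blowup (.left x l)

theorem mid (P L : List ℤ) (a b : ℤ) :
    SeqEquiv (P ++ a :: b :: L) (P ++ (a - 1) :: -1 :: (b - 1) :: L) :=
  of_blowup (.mid P L a b)

theorem right (l : List ℤ) (x : ℤ) : SeqEquiv (l ++ [x]) (l ++ [x - 1, -1]) :=
  of_blowup (.right l x)

/-- Equality of two functions of an integer up to equivalence can be checked on successors. -/
theorem of_succ {f : ℤ → List ℤ} (h : ∀ x, SeqEquiv (f x) (f (x + 1))) (x y : ℤ) :
    SeqEquiv (f x) (f y) := by
  have key : ∀ z, SeqEquiv (f 0) (f z) := by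
    intro z
    induction z using Int.induction_on with
    | zero => exact refl _
    | succ i ih => exact ih.trans (h _)
    | pred i ih => exact ih.trans (by simpa using (h (-(i : ℤ) - 1)).symm)
  exact (key x).symm.trans (key y)

/-- A unit of weight can be moved across a zero. -/
theorem transfer (P L : List ℤ) (s x y : ℤ) :
    SeqEquiv (P ++ x :: 0 :: (s - x) :: L) (P ++ y :: 0 :: (s - y) :: L) := by
  refine of_succ (f := fun x => P ++ x :: 0 :: (s - x) :: L) (fun x => ?_) x y
  have h₁ := mid P ((s - x - 1) :: L) (x + 1) 0
  have h₂ := mid (P ++ [x]) L 0 (s - x)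
  simp only [add_sub_cancel_right, zero_sub, List.append_assoc, List.cons_append,
    List.nil_append] at h₁ h₂
  simpa [sub_sub] using h₂.trans h₁.symm

/-- The term next to a final zero is arbitrary. -/
theorem change_right (P : List ℤ) (x y : ℤ) : SeqEquiv (P ++ [x, 0]) (P ++ [y, 0]) := by
  refine of_succ (f := fun x => P ++ [x, 0]) (fun x => ?_) x y
  have h₁ := mid P [] (x + 1) 0
  have h₂ := right (P ++ [x]) 0
  simp only [add_sub_cancel_right, zero_sub, List.append_assoc, List.cons_append,
    List.nil_append] at h₁ h₂
  exact h₂.trans h₁.symm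

/-- The term next to an initial zero is arbitrary. -/
theorem change_left (L : List ℤ) (x y : ℤ) : SeqEquiv (0 :: x :: L) (0 :: y :: L) := by
  refine of_succ (f := fun x => 0 :: x :: L) (fun x => ?_) x y
  have h₁ := left 0 (x :: L)
  have h₂ := mid [] L 0 (x + 1)
  simp only [add_sub_cancel_right, zero_sub, List.nil_append] at h₁ h₂
  exact h₁.trans h₂.symm

/-- A pair of zeros can be moved to the front. -/
theorem zeros_to_front (P L : List ℤ) :
    SeqEquiv (P ++ 0 :: 0 :: L) (0 :: 0 :: (P ++ L)) := by
  induction P using List.reverseRecOn generalizing L with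
  | nil => exact refl _
  | append_singleton P x ih =>
    have h := transfer P L x x 0
    simp only [sub_self, sub_zero] at h
    simpa using h.trans (ih (x :: L))

theorem zero_zero_cons_of_blowup {X Y : List ℤ} (h : SeqBlowup X Y) :
    SeqEquiv (0 :: 0 :: X) (0 :: 0 :: Y) := by
  cases h with
  | empty => exact (right [0] 0).trans (change_left _ _ _)
  | left x l => exact (mid [0] l 0 x).trans (change_left _ _ _)
  | mid P L a b => exact mid (0 :: 0 :: P) L a b
  | right l x => exact right (0 :: 0 :: l) x

theorem zero_zero_cons {X Y : List ℤ} (h : SeqEquiv X Y) :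
    SeqEquiv (0 :: 0 :: X) (0 :: 0 :: Y) := by
  induction h with
  | rel _ _ h => exact zero_zero_cons_of_blowup h
  | refl _ => exact refl _
  | symm _ _ _ ih => exact ih.symm
  | trans _ _ _ _ _ ih ih' => exact ih.trans ih'

/-- Prepending a term respects equivalence up to a shift of that term. -/
theorem exists_cons_shift {X Y : List ℤ} (h : SeqEquiv X Y) :
    ∃ k : ℤ, ∀ x, SeqEquiv (x :: X) ((x + k) :: Y) := by
  induction h with
  | rel _ _ h =>
    cases h with
    | empty => exact ⟨-1, fun x => right [] x⟩
    | left y l => exact ⟨-1, fun x => mid [] l x y⟩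
    | mid P L a b => exact ⟨0, fun x => by simpa using mid (x :: P) L a b⟩
    | right l y => exact ⟨0, fun x => by simpa using right (x :: l) y⟩
  | refl _ => exact ⟨0, fun x => by simpa using refl _⟩
  | symm _ _ _ ih =>
    obtain ⟨k, hk⟩ := ih
    exact ⟨-k, fun x => by simpa using (hk (x + -k)).symm⟩
  | trans _ _ _ _ _ ih ih' =>
    obtain ⟨k, hk⟩ := ih
    obtain ⟨l, hl⟩ := ih'
    exact ⟨k + l, fun x => by simpa [add_assoc] using (hk x).trans (hl (x + k))⟩

theorem expand_head (n : ℕ) (c : ℤ) (L : List ℤ) :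
    SeqEquiv ((n + 1 + c) :: L) (List.replicate n (-2) ++ -1 :: c :: L) := by
  induction n generalizing c with
  | zero => simpa using left (1 + c) L
  | succ n ih =>
    have h := (ih (c + 1)).trans (mid (List.replicate n (-2)) L (-1) (c + 1))
    have e : ((n + 1 : ℕ) : ℤ) + 1 + c = n + 1 + (c + 1) := by push_cast; ring
    rw [e, List.replicate_succ']
    simpa using h

end SeqEquiv

/-- `X` is equivalent to some canonical sequence. -/
def HasCanonicalForm (X : List ℤ) : Prop := ∃ C, IsCanonicalSeq C ∧ SeqEquiv X C

namespace HasCanonicalForm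

theorem of_equiv {X Y : List ℤ} (h : SeqEquiv X Y) : HasCanonicalForm Y → HasCanonicalForm X :=
  fun ⟨C, hC, hY⟩ => ⟨C, hC, h.trans hY⟩

theorem of_admissible {A : List ℤ} (hA : IsAdmissible A) : HasCanonicalForm A :=
  ⟨A, ⟨0, A, hA, by simp, by simp⟩, .refl _⟩

theorem zero_zero_cons {X : List ℤ} : HasCanonicalForm X → HasCanonicalForm (0 :: 0 :: X) := by
  rintro ⟨_, ⟨r, A, hA, hr, rfl⟩, hX⟩
  exact ⟨_, ⟨r + 2, A, hA, fun h => (hr h).add even_two, rfl⟩, hX.zero_zero_cons⟩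

theorem cons_admissible {A : List ℤ} (hA : IsAdmissible A) (x : ℤ) :
    HasCanonicalForm (x :: A) := by
  induction A generalizing x with
  | nil =>
    obtain hx | rfl | rfl | hx : x < -1 ∨ x = -1 ∨ x = 0 ∨ 0 < x := by omega
    · exact of_admissible (by simpa [IsAdmissible] using hx)
    · exact of_equiv (SeqEquiv.of_blowup .empty).symm (of_admissible hA)
    · exact ⟨[0], ⟨1, [], hA, by simp, rfl⟩, .refl _⟩
    · obtain ⟨n, rfl⟩ : ∃ n : ℕ, x = n + 1 := ⟨(x - 1).toNat, by omega⟩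
      have h := ((SeqEquiv.expand_head n 0 []).trans (.change_right _ _ 0)).trans
        (.zeros_to_front _ _)
      rw [add_zero] at h
      refine of_equiv h (zero_zero_cons (of_admissible fun a ha => ?_))
      simp only [List.append_nil, List.mem_replicate] at ha
      omega
  | cons a A ih =>
    have ha : a < -1 := hA a (by simp)
    have hA' : IsAdmissible A := fun b hb => hA b (by simp [hb])
    obtain hx | rfl | rfl | hx : x < -1 ∨ x = -1 ∨ x = 0 ∨ 0 < x := by omega
    · exact of_admissible (List.forall_mem_cons.2 ⟨hx, hA⟩)
    · refine of_equiv (SeqEquiv.symm ?_) (ih hA' (a + 1))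
      simpa using SeqEquiv.left (a + 1) A
    · exact of_equiv (.change_left _ _ 0) (zero_zero_cons (of_admissible hA'))
    · obtain ⟨n, rfl⟩ : ∃ n : ℕ, x = n + 1 := ⟨(x - 1).toNat, by omega⟩
      have h := SeqEquiv.expand_head n 0 (a :: A)
      have h' := (SeqEquiv.transfer (List.replicate n (-2)) A (a - 1) (-1) 0).trans
        (.zeros_to_front _ _)
      rw [add_zero] at h
      rw [sub_neg_eq_add, sub_add_cancel, sub_zero] at h'
      refine of_equiv (h.trans h') (zero_zero_cons (of_admissible fun b hb => ?_))
      simp only [List.mem_append, List.mem_replicate, List.mem_cons] at hb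
      rcases hb with hb | hb | hb
      · omega
      · omega
      · exact hA' b hb

theorem cons_canonical {A : List ℤ} (hA : IsAdmissible A) (x : ℤ) :
    ∀ r : ℕ, (A ≠ [] → Even r) → HasCanonicalForm (x :: (List.replicate r 0 ++ A))
  | 0, _ => cons_admissible hA x
  | 1, hr => by
    obtain rfl : A = [] := by by_contra h; simpa using hr h
    exact of_equiv (.change_right [] x 0) (zero_zero_cons (of_admissible hA))
  | r + 2, hr => by
    have h := SeqEquiv.zeros_to_front [x] (List.replicate r 0 ++ A)
    refine of_equiv h (zero_zero_cons (cons_canonical hA x r fun h => ?_))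
    simpa [Nat.even_add] using hr h

end HasCanonicalForm

theorem hasCanonicalForm (X : List ℤ) : HasCanonicalForm X := by
  induction X with
  | nil => exact .of_admissible (by simp [IsAdmissible])
  | cons x X ih =>
    obtain ⟨_, ⟨r, A, hA, hr, rfl⟩, hX⟩ := ih
    obtain ⟨k, hk⟩ := hX.exists_cons_shift
    exact .of_equiv (hk x) (.cons_canonical hA _ r hr)

/-- A nonzero vector of the plane lifted to the universal cover of the punctured plane: `(p, q)`
is the representative up to sign in the upper half plane, and `m` counts half turns. -/
structure LiftedVector where
  p : ℤ
  q : ℤ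
  m : ℤ

namespace LiftedVector

/-- `(p, q)` lies in the half-open upper half plane. -/
def IsUpper (s : LiftedVector) : Prop := 0 < s.q ∨ (s.q = 0 ∧ 0 < s.p)

/-- The shear `(p, q) ↦ (p + k q, q)`. -/
def shear (k : ℤ) (s : LiftedVector) : LiftedVector := ⟨s.p + k * s.q, s.q, s.m⟩

/-- The clockwise quarter turn. -/
def rot (s : LiftedVector) : LiftedVector :=
  if s.p ≤ 0 then ⟨s.q, -s.p, s.m⟩ else ⟨-s.q, s.p, s.m + 1⟩

/-- The action of a single term of a sequence. -/
def turn (x : ℤ) (s : LiftedVector) : LiftedVector := rot (shear x s)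

/-- The lifted vector of a sequence. -/
def ofSeq (X : List ℤ) : LiftedVector := X.foldr turn ⟨0, 1, 0⟩

/-- The orbit of a lifted vector under shears. -/
def orbit (s : LiftedVector) : LiftedVector := ⟨s.p % s.q, s.q, s.m⟩

theorem IsUpper.shear {s : LiftedVector} (hs : s.IsUpper) (k : ℤ) : (s.shear k).IsUpper := by
  obtain h | ⟨h, h'⟩ := hs
  · exact .inl h
  · exact .inr ⟨h, by simpa [LiftedVector.shear, h] using h'⟩

theorem IsUpper.rot {s : LiftedVector} (hs : s.IsUpper) : s.rot.IsUpper := by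
  unfold LiftedVector.rot
  split_ifs <;> simp only [IsUpper] at * <;> omega

theorem isUpper_ofSeq (X : List ℤ) : (ofSeq X).IsUpper := by
  induction X with
  | nil => exact .inl one_pos
  | cons x X ih => exact (ih.shear x).rot

theorem shear_shear (j k : ℤ) (s : LiftedVector) : (s.shear k).shear j = s.shear (j + k) := by
  simp only [shear, mk.injEq, and_true]
  ring

theorem rot_shear_rot {s : LiftedVector} (hs : s.IsUpper) :
    (s.rot.shear (-1)).rot = ((s.shear 1).rot).shear 1 := by
  grind [IsUpper, rot, shear]

theorem turn_neg_one_turn (x : ℤ) {s : LiftedVector} (hs : s.IsUpper) :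
    turn (-1) (turn (x - 1) s) = (turn x s).shear 1 := by
  simp only [turn]
  rw [rot_shear_rot (hs.shear _), shear_shear]
  simp

theorem turn_turn_turn (a b : ℤ) {s : LiftedVector} (hs : s.IsUpper) :
    turn (a - 1) (turn (-1) (turn (b - 1) s)) = turn a (turn b s) := by
  rw [turn_neg_one_turn b hs, turn, shear_shear, sub_add_cancel]
  rfl

theorem orbit_shear (k : ℤ) (s : LiftedVector) : (s.shear k).orbit = s.orbit := by
  simp [orbit, shear]

theorem ofSeq_append (X Y : List ℤ) : ofSeq (X ++ Y) = X.foldr turn (ofSeq Y) :=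
  List.foldr_append

theorem orbit_ofSeq_of_blowup {X Y : List ℤ} (h : SeqBlowup X Y) :
    (ofSeq X).orbit = (ofSeq Y).orbit := by
  cases h with
  | empty => rfl
  | left x l =>
    have h := turn_neg_one_turn x (isUpper_ofSeq l)
    exact ((congrArg orbit h).trans (orbit_shear _ _)).symm
  | mid P L a b =>
    rw [ofSeq_append, ofSeq_append]
    exact congrArg (fun s => (P.foldr turn s).orbit) (turn_turn_turn a b (isUpper_ofSeq L)).symm
  | right l x =>
    rw [ofSeq_append, ofSeq_append]
    refine congrArg (fun s => (l.foldr turn s).orbit) ?_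
    simp [ofSeq, turn, shear, rot]

theorem orbit_ofSeq_of_equiv {X Y : List ℤ} (h : SeqEquiv X Y) :
    (ofSeq X).orbit = (ofSeq Y).orbit := by
  induction h with
  | rel _ _ h => exact orbit_ofSeq_of_blowup h
  | refl _ => rfl
  | symm _ _ _ ih => exact ih.symm
  | trans _ _ _ _ _ ih ih' => exact ih.trans ih'

theorem turn_of_reduced {x : ℤ} (hx : x < -1) {s : LiftedVector} (hp : 0 ≤ s.p) (hq : s.p < s.q) :
    turn x s = ⟨s.q, -(s.p + x * s.q), s.m⟩ ∧ s.q < -(s.p + x * s.q) := by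
  have h : s.q < -(s.p + x * s.q) := by nlinarith
  exact ⟨if_pos (by simp only [shear]; omega), h⟩

theorem ofSeq_admissible {A : List ℤ} (hA : IsAdmissible A) :
    0 ≤ (ofSeq A).p ∧ (ofSeq A).p < (ofSeq A).q ∧ (ofSeq A).m = 0 ∧
      (A ≠ [] → 0 < (ofSeq A).p) := by
  induction A with
  | nil => simp [ofSeq]
  | cons a A ih =>
    obtain ⟨hp, hq, hm, -⟩ := ih fun b hb => hA b (by simp [hb])
    obtain ⟨e, h⟩ := turn_of_reduced (hA a (by simp)) hp hq
    have e' : ofSeq (a :: A) = _ := e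
    rw [e']
    exact ⟨by simp only; omega, h, hm, fun _ => by simp only; omega⟩

theorem ofSeq_injOn_admissible {A B : List ℤ} (hA : IsAdmissible A) (hB : IsAdmissible B)
    (h : ofSeq A = ofSeq B) : A = B := by
  induction A generalizing B with
  | nil =>
    by_contra hne
    have := (ofSeq_admissible hB).2.2.2 (Ne.symm hne)
    rw [← h] at this
    exact absurd this (lt_irrefl 0)
  | cons a A ih =>
    cases B with
    | nil =>
      have := (ofSeq_admissible hA).2.2.2 (by simp)
      rw [h] at this
      exact absurd this (lt_irrefl 0)
    | cons b B =>
      have hA' : IsAdmissible A := fun c hc => hA c (by simp [hc])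
      have hB' : IsAdmissible B := fun c hc => hB c (by simp [hc])
      obtain ⟨hp, hq, hm, -⟩ := ofSeq_admissible hA'
      obtain ⟨hp', hq', hm', -⟩ := ofSeq_admissible hB'
      have e : turn a (ofSeq A) = turn b (ofSeq B) := h
      rw [(turn_of_reduced (hA a (by simp)) hp hq).1,
        (turn_of_reduced (hB b (by simp)) hp' hq').1, mk.injEq] at e
      obtain ⟨e₁, e₂, -⟩ := e
      rw [← e₁] at e₂ hq'
      have hpp : (ofSeq A).p = (ofSeq B).p := by
        have := congrArg (· % (ofSeq A).q) (neg_injective e₂)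
        simpa [Int.emod_eq_of_lt hp hq, Int.emod_eq_of_lt hp' hq'] using this
      have hab : a = b := by
        rw [hpp] at e₂
        exact mul_right_cancel₀ (by omega : (ofSeq A).q ≠ 0) (by linarith)
      rw [hab, ih hA' hB' (by
        cases hs : ofSeq A; cases ht : ofSeq B; simp_all)]

theorem turn_zero_turn_zero {s : LiftedVector} (hs : s.IsUpper) :
    turn 0 (turn 0 s) = ⟨s.p, s.q, s.m + 1⟩ := by
  grind [IsUpper, turn, rot, shear]

theorem ofSeq_replicate_even_append (k : ℕ) (X : List ℤ) :
    ofSeq (List.replicate (k + k) 0 ++ X) = ⟨(ofSeq X).p, (ofSeq X).q, (ofSeq X).m + k⟩ := by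
  induction k with
  | zero => simp
  | succ k ih =>
    have e : ofSeq (List.replicate (k + 1 + (k + 1)) 0 ++ X) =
        turn 0 (turn 0 (ofSeq (List.replicate (k + k) 0 ++ X))) := by
      rw [show k + 1 + (k + 1) = k + k + 1 + 1 by ring]
      rfl
    rw [e, turn_zero_turn_zero (isUpper_ofSeq _), ih]
    simp [add_assoc]

end LiftedVector

open LiftedVector in
/-- A canonical sequence either is a string of an odd number of zeros or starts with an even
number of zeros; the shear orbit of its lifted vector is accordingly reduced. -/
theorem IsCanonicalSeq.orbit_cases {C : List ℤ} (hC : IsCanonicalSeq C) :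
    (∃ k : ℕ, C = List.replicate (k + k + 1) 0 ∧ (ofSeq C).orbit = ⟨1, 0, k⟩) ∨
    ∃ (k : ℕ) (A : List ℤ), IsAdmissible A ∧ C = List.replicate (k + k) 0 ++ A ∧
      0 < (ofSeq A).q ∧ (ofSeq C).orbit = ⟨(ofSeq A).p, (ofSeq A).q, k⟩ := by
  obtain ⟨r, A, hA, hr, rfl⟩ := hC
  obtain ⟨k, rfl⟩ | ⟨k, rfl⟩ := r.even_or_odd
  · obtain ⟨hp, hq, hm, -⟩ := ofSeq_admissible hA
    refine .inr ⟨k, A, hA, rfl, by omega, ?_⟩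
    rw [ofSeq_replicate_even_append]
    simp [orbit, Int.emod_eq_of_lt hp hq, hm]
  · obtain rfl : A = [] := by
      by_contra h
      exact Nat.not_even_two_mul_add_one k (hr h)
    refine .inl ⟨k, by simp [two_mul], ?_⟩
    rw [List.append_nil, two_mul, List.replicate_succ', ofSeq_replicate_even_append]
    simp [orbit, ofSeq, turn, rot, shear]

/-- Equivalent canonical sequences are equal. -/
theorem IsCanonicalSeq.eq_of_equiv {C C' : List ℤ} (hC : IsCanonicalSeq C)
    (hC' : IsCanonicalSeq C') (h : SeqEquiv C C') : C = C' := by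
  have e := LiftedVector.orbit_ofSeq_of_equiv h
  obtain ⟨k, rfl, o⟩ | ⟨k, A, hA, rfl, hq, o⟩ := hC.orbit_cases <;>
  obtain ⟨k', rfl, o'⟩ | ⟨k', A', hA', rfl, hq', o'⟩ := hC'.orbit_cases <;>
  rw [o, o', LiftedVector.mk.injEq] at e
  · obtain rfl : k = k' := by omega
    rfl
  · omega
  · omega
  · obtain rfl : k = k' := by omega
    obtain ⟨-, -, hm, -⟩ := LiftedVector.ofSeq_admissible hA
    obtain ⟨-, -, hm', -⟩ := LiftedVector.ofSeq_admissible hA'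
    rw [LiftedVector.ofSeq_injOn_admissible hA hA' (by
      cases hs : LiftedVector.ofSeq A; cases ht : LiftedVector.ofSeq A'; simp_all)]

/-- **Theorem (classification of sequences).** Every finite sequence of integers is
equivalent to exactly one canonical sequence. -/
theorem every_sequence_equivalent_to_unique_canonical :
    (∀ X : List ℤ, ∃ C : List ℤ, IsCanonicalSeq C ∧ SeqEquiv X C) ∧
    (∀ C C' : List ℤ, IsCanonicalSeq C → IsCanonicalSeq C' → SeqEquiv C C' → C = C') := by
  exact ⟨hasCanonicalForm, fun _ _ hC hC' h => hC.eq_of_equiv hC' h⟩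
end

section
/- Let L ∈ ℤ*, let n = hodge(L), let d be the absolute value of det(L), and suppose (0^r, A), with r ∈ ℕ and A admissible, is a canonical sequence equivalent to L. Then: (a) if d = 0 then r = 2n - 1 and A = ∅; (b) if d ≠ 0 then r = 2n, det(A) = d, and Subbar(A) = (-1)^n · Subbar(L) in ℤ/dℤ × ℤ/dℤ. -/
/-- The determinant of the matrix `-M(X)`, where `M(X)` is the intersection matrix of
the sequence `X` (diagonal `xᵢ`, `1` on the off-diagonals `|i-j| = 1`); `det(∅) = 1`. -/
def seqDet : List ℤ → ℤ
  | [] => 1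
  | [x] => -x
  | x :: y :: l => -x * seqDet (y :: l) - seqDet l

/-- `det₁(x₁,…,xₙ) = det(x₂,…,xₙ)`, with `det₁(∅) = 0`. -/
def seqDet1 : List ℤ → ℤ
  | [] => 0
  | _ :: l => seqDet l

/-- The intersection form of the sequence `X`: the symmetric bilinear form on `ℝⁿ`
(`n = length of X`) whose matrix has `xᵢ` on the diagonal and `1` in positions
`(i,j)` with `|i-j| = 1`, evaluated at `(v, v)`. -/
noncomputable def seqForm (X : List ℤ) (v : Fin X.length → ℝ) : ℝ :=
  ∑ i, ∑ j, v i * (if i = j then ((X.get i : ℤ) : ℝ)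
    else if i.val + 1 = j.val ∨ j.val + 1 = i.val then 1 else 0) * v j

/-- `hodge(X)`: the maximal dimension of a linear subspace of `ℝⁿ` on which the
intersection form of `X` is nonnegative. -/
noncomputable def seqHodge (X : List ℤ) : ℕ :=
  sSup { k | ∃ W : Submodule ℝ (Fin X.length → ℝ),
      Module.finrank ℝ W = k ∧ ∀ v ∈ W, 0 ≤ seqForm X v }

/-- The transfer matrix of a sequence: a product of `2 × 2` matrices whose entries are the
determinants of the sequence with its end terms kept or removed. -/
def seqMat : List ℤ → Matrix (Fin 2) (Fin 2) ℤ
  | [] => 1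
  | x :: l => !![-x, -1; 1, 0] * seqMat l

theorem seqMat_append (A B : List ℤ) : seqMat (A ++ B) = seqMat A * seqMat B := by
  induction A with
  | nil => simp [seqMat]
  | cons x l ih => simp [seqMat, ih]

theorem seqDet_cons (x : ℤ) (l : List ℤ) : seqDet (x :: l) = -x * seqDet l - seqDet1 l := by
  cases l <;> simp [seqDet, seqDet1]

theorem seqMat_col (X : List ℤ) : seqMat X 0 0 = seqDet X ∧ seqMat X 1 0 = seqDet1 X := by
  induction X with
  | nil => simp [seqMat, seqDet, seqDet1]
  | cons x l ih =>
    rw [seqDet_cons]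
    simp [seqMat, seqDet1, Matrix.mul_apply, Fin.sum_univ_two, ih.1, ih.2]
    ring

theorem seqMat_reverse (X : List ℤ) :
    seqMat X.reverse = !![1, 0; 0, -1] * (seqMat X).transpose * !![1, 0; 0, -1] := by
  induction X with
  | nil =>
    ext i j
    fin_cases i <;> fin_cases j <;> simp [seqMat, Matrix.mul_apply, Fin.sum_univ_two]
  | cons x l ih =>
    rw [List.reverse_cons, seqMat_append, ih]
    ext i j
    fin_cases i <;> fin_cases j <;>
      simp [seqMat, Matrix.mul_apply, Fin.sum_univ_two, Matrix.vecMul, dotProduct] <;> ring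

theorem seqMat_zero_one (X : List ℤ) : seqMat X 0 1 = -seqDet1 X.reverse := by
  rw [← (seqMat_col X.reverse).2, seqMat_reverse]
  simp [Matrix.mul_apply, Fin.sum_univ_two, Matrix.vecMul, dotProduct]

/-- Equality of determinants together with congruence of the subdeterminants modulo them. -/
def SeqDetCongr (X Y : List ℤ) : Prop :=
  seqDet X = seqDet Y ∧ seqDet1 X ≡ seqDet1 Y [ZMOD seqDet X] ∧
    seqDet1 X.reverse ≡ seqDet1 Y.reverse [ZMOD seqDet X]

theorem SeqDetCongr.symm {X Y : List ℤ} (h : SeqDetCongr X Y) : SeqDetCongr Y X :=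
  ⟨h.1.symm, h.1 ▸ h.2.1.symm, h.1 ▸ h.2.2.symm⟩

theorem SeqDetCongr.trans {X Y Z : List ℤ} (h : SeqDetCongr X Y) (h' : SeqDetCongr Y Z) :
    SeqDetCongr X Z :=
  ⟨h.1.trans h'.1, h.2.1.trans (h.1 ▸ h'.2.1), h.2.2.trans (h.1 ▸ h'.2.2)⟩

theorem seqDetCongr_of_seqMat {X Y : List ℤ} (a b : ℤ)
    (h : seqMat Y = !![1, 0; a, 1] * seqMat X ∨ seqMat Y = seqMat X * !![1, b; 0, 1]) :
    SeqDetCongr X Y := by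
  have e (Z : List ℤ) : seqDet1 Z.reverse = -seqMat Z 0 1 := by rw [seqMat_zero_one]; ring
  rw [SeqDetCongr, e, e, ← (seqMat_col X).1, ← (seqMat_col X).2, ← (seqMat_col Y).1,
    ← (seqMat_col Y).2]
  rcases h with h | h <;> rw [h] <;>
    simp [Matrix.mul_apply, Fin.sum_univ_two, Int.modEq_iff_dvd]

theorem SeqBlowup.seqDetCongr {X Y : List ℤ} (h : SeqBlowup X Y) : SeqDetCongr X Y := by
  cases h with
  | empty => simp [SeqDetCongr, seqDet, seqDet1, Int.modEq_one]
  | left x l =>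
    refine seqDetCongr_of_seqMat 1 0 (Or.inl ?_)
    simp only [seqMat, ← Matrix.mul_assoc]
    congr 1
    ext i j
    fin_cases i <;> fin_cases j <;> simp [Matrix.mul_apply, Fin.sum_univ_two] <;> ring
  | mid A B a b =>
    refine seqDetCongr_of_seqMat 0 0 (Or.inr ?_)
    have h1 : (!![1, 0; 0, 1] : Matrix (Fin 2) (Fin 2) ℤ) = 1 := Matrix.one_fin_two.symm
    rw [h1, mul_one, seqMat_append, seqMat_append]
    simp only [seqMat, ← Matrix.mul_assoc]
    congr 1
    simp only [Matrix.mul_assoc]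
    congr 1
    ext i j
    fin_cases i <;> fin_cases j <;> simp [Matrix.mul_apply, Fin.sum_univ_two] <;> ring
  | right l x =>
    refine seqDetCongr_of_seqMat 0 (-1) (Or.inr ?_)
    rw [seqMat_append, seqMat_append, Matrix.mul_assoc]
    congr 1
    ext i j
    fin_cases i <;> fin_cases j <;> simp [seqMat, Matrix.mul_apply, Fin.sum_univ_two] <;> ring

theorem SeqEquiv.seqDetCongr {X Y : List ℤ} (h : SeqEquiv X Y) : SeqDetCongr X Y := by
  induction h with
  | rel _ _ h => exact h.seqDetCongr
  | refl _ => exact ⟨rfl, rfl, rfl⟩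
  | symm _ _ _ ih => exact ih.symm
  | trans _ _ _ _ _ ih ih' => exact ih.trans ih'

theorem seqMat_replicate_two_mul (k : ℕ) (A : List ℤ) :
    seqMat (List.replicate (2 * k) 0 ++ A) = (-1) ^ k * seqMat A := by
  induction k with
  | zero => simp
  | succ k ih =>
    have h : List.replicate (2 * (k + 1)) (0 : ℤ) ++ A
        = 0 :: 0 :: (List.replicate (2 * k) 0 ++ A) := by
      simp [Nat.mul_succ, List.replicate_succ]
    have h0 : (!![0, -1; 1, 0] * !![0, -1; 1, 0] : Matrix (Fin 2) (Fin 2) ℤ) = -1 := by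
      ext i j
      fin_cases i <;> fin_cases j <;> simp [Matrix.mul_apply, Fin.sum_univ_two]
    rw [h, seqMat, seqMat, ih, ← Matrix.mul_assoc, neg_zero, h0, pow_succ' (-1 : Matrix _ _ ℤ),
      Matrix.mul_assoc]

theorem seqMat_replicate_two_mul_apply (k : ℕ) (A : List ℤ) (i j : Fin 2) :
    seqMat (List.replicate (2 * k) 0 ++ A) i j = (-1) ^ k * seqMat A i j := by
  rw [seqMat_replicate_two_mul]
  rcases neg_one_pow_eq_or ℤ k with h | h <;> rcases Nat.even_or_odd k with h' | h' <;>
    simp [h'.neg_one_pow]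

theorem IsAdmissible.seqDet1_lt_seqDet {A : List ℤ} (h : IsAdmissible A) :
    0 ≤ seqDet1 A ∧ seqDet1 A < seqDet A := by
  induction A with
  | nil => simp [seqDet, seqDet1]
  | cons x l ih =>
    obtain ⟨h0, h1⟩ := ih fun a ha => h a (List.mem_cons_of_mem _ ha)
    have hx : x < -1 := h x List.mem_cons_self
    rw [seqDet_cons]
    change 0 ≤ seqDet l ∧ seqDet l < _
    constructor <;> nlinarith

/-- The intersection form of a sequence, evaluated on a list of coordinates. -/
def seqListForm : List ℤ → List ℝ → ℝ
  | x :: l, a :: m => a * (x * a + 2 * m.headD 0) + seqListForm l m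
  | _, _ => 0

theorem seqForm_eq_seqListForm (X : List ℤ) (v : Fin X.length → ℝ) :
    seqForm X v = seqListForm X (List.ofFn v) := by
  induction X with
  | nil => simp [seqForm, seqListForm]
  | cons x l ih =>
    have e : List.ofFn v = v 0 :: List.ofFn (fun i : Fin l.length => v i.succ) :=
      List.ofFn_succ
    rw [e, seqListForm, ← ih]
    unfold seqForm
    simp only [List.length_cons, Fin.sum_univ_succ]
    cases l with
    | nil => simp; ring
    | cons y l =>
      simp [Fin.sum_univ_succ, Fin.succ_ne_zero, (Fin.succ_ne_zero _).symm]
      ring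

/-- The linear combination of the neighbours of a new coordinate inserted between two lists. -/
def neighbourSum {M : Type*} [AddZeroClass M] (m n : List M) : M :=
  m.getLastD 0 + n.headD 0

theorem seqListForm_blowup {X Y : List ℤ} (h : SeqBlowup X Y) :
    ∃ p q : ℕ, X.length = p + q ∧ Y.length = p + (q + 1) ∧
      ∀ (m n : List ℝ) (e : ℝ), m.length = p → n.length = q →
        seqListForm Y (m ++ e :: n) = seqListForm X (m ++ n) - (e - neighbourSum m n) ^ 2 := by
  cases h with
  | empty =>
    refine ⟨0, 0, rfl, rfl, fun m n e hm hn => ?_⟩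
    obtain rfl := List.length_eq_zero_iff.1 hm
    obtain rfl := List.length_eq_zero_iff.1 hn
    simp [seqListForm, neighbourSum]
    ring
  | left x l =>
    refine ⟨0, l.length + 1, by simp, by simp, fun m n e hm hn => ?_⟩
    obtain rfl := List.length_eq_zero_iff.1 hm
    obtain ⟨f, n, rfl⟩ := List.exists_cons_of_length_eq_add_one hn
    simp [seqListForm, neighbourSum]
    ring
  | mid A B a b =>
    refine ⟨A.length + 1, B.length + 1, by simp; ring, by simp; ring, fun m n e hm hn => ?_⟩
    obtain ⟨g, n, rfl⟩ := List.exists_cons_of_length_eq_add_one hn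
    induction A generalizing m with
    | nil =>
      obtain ⟨f, rfl⟩ := List.length_eq_one_iff.1 hm
      simp [seqListForm, neighbourSum]
      ring
    | cons z A ih =>
      obtain ⟨c, m, rfl⟩ := List.exists_cons_of_length_eq_add_one hm
      have hm' : m.length = A.length + 1 := by simpa using hm
      have := ih m hm'
      obtain ⟨d, m, rfl⟩ := List.exists_cons_of_length_eq_add_one hm'
      simp only [List.cons_append, seqListForm, neighbourSum, List.headD_cons,
        List.getLastD_cons] at this ⊢
      rw [this]
      ring
  | right l x =>
    refine ⟨l.length + 1, 0, by simp, by simp, fun m n e hm hn => ?_⟩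
    obtain rfl := List.length_eq_zero_iff.1 hn
    induction l generalizing m with
    | nil =>
      obtain ⟨f, rfl⟩ := List.length_eq_one_iff.1 hm
      simp [seqListForm, neighbourSum]
      ring
    | cons z A ih =>
      obtain ⟨c, m, rfl⟩ := List.exists_cons_of_length_eq_add_one hm
      have hm' : m.length = A.length + 1 := by simpa using hm
      have := ih m hm'
      obtain ⟨d, m, rfl⟩ := List.exists_cons_of_length_eq_add_one hm'
      simp only [List.cons_append, List.append_nil, seqListForm, neighbourSum, List.headD_cons,
        List.headD_nil, List.getLastD_cons] at this ⊢
      rw [this]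
      ring

/-- The form of `X` is nonnegative on some `k`-dimensional space, given by the list of its
coordinate functionals. -/
def HasNonnegSpace (X : List ℤ) (k : ℕ) : Prop :=
  ∃ fs : List (Module.Dual ℝ (Fin k → ℝ)), fs.length = X.length ∧
    (∀ u, (∀ f ∈ fs, f u = 0) → u = 0) ∧ ∀ u, 0 ≤ seqListForm X (fs.map (· u))

theorem hasNonnegSpace_iff (X : List ℤ) (k : ℕ) :
    HasNonnegSpace X k ↔ ∃ W : Submodule ℝ (Fin X.length → ℝ),
      Module.finrank ℝ W = k ∧ ∀ v ∈ W, 0 ≤ seqForm X v := by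
  constructor
  · rintro ⟨fs, hl, hi, hn⟩
    let φ : (Fin k → ℝ) →ₗ[ℝ] (Fin X.length → ℝ) :=
      LinearMap.pi fun i => fs.get (i.cast hl.symm)
    have hφ : Function.Injective φ := by
      rw [← LinearMap.ker_eq_bot, LinearMap.ker_eq_bot']
      intro u hu
      refine hi u fun f hf => ?_
      obtain ⟨i, rfl⟩ := List.get_of_mem hf
      simpa [φ] using congrFun hu (i.cast hl)
    refine ⟨LinearMap.range φ, by simp [LinearMap.finrank_range_of_inj hφ], ?_⟩
    rintro _ ⟨u, rfl⟩
    rw [seqForm_eq_seqListForm]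
    convert hn u
    apply List.ext_getElem <;> simp [hl, φ]
  · rintro ⟨W, hW, hn⟩
    let e : (Fin k → ℝ) ≃ₗ[ℝ] W := LinearEquiv.ofFinrankEq _ _ (by simp [hW])
    refine ⟨List.ofFn fun i => LinearMap.proj i ∘ₗ W.subtype ∘ₗ e.toLinearMap, by simp, ?_, ?_⟩
    · intro u hu
      rw [List.forall_mem_ofFn_iff] at hu
      apply e.injective
      ext i
      simpa using hu i
    · intro u
      have := hn (e u) (e u).2
      rw [seqForm_eq_seqListForm] at this
      convert this
      simp [List.map_ofFn, Function.comp_def]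

theorem seqHodge_eq (X : List ℤ) : seqHodge X = sSup {k | HasNonnegSpace X k} := by
  simp only [seqHodge, hasNonnegSpace_iff]

theorem neighbourSum_map {k : ℕ} (m n : List (Module.Dual ℝ (Fin k → ℝ))) (u : Fin k → ℝ) :
    neighbourSum (m.map (· u)) (n.map (· u)) = neighbourSum m n u := by
  have h1 : (m.map (· u)).getLastD 0 = m.getLastD 0 u := by
    rcases List.eq_nil_or_concat m with rfl | ⟨l, a, rfl⟩ <;> simp
  have h2 : (n.map (· u)).headD 0 = n.headD 0 u := by cases n <;> simp
  rw [neighbourSum, h1, h2]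
  rfl

theorem seqListForm_eq_zero (X : List ℤ) (m : List ℝ) (h : ∀ a ∈ m, a = 0) :
    seqListForm X m = 0 := by
  induction X generalizing m with
  | nil => simp [seqListForm]
  | cons x l ih =>
    cases m with
    | nil => simp [seqListForm]
    | cons a m =>
      rw [seqListForm, ih m fun b hb => h b (List.mem_cons_of_mem _ hb), h a List.mem_cons_self]
      simp

theorem SeqBlowup.hasNonnegSpace_iff {X Y : List ℤ} (h : SeqBlowup X Y) (k : ℕ) :
    HasNonnegSpace X k ↔ HasNonnegSpace Y k := by
  obtain ⟨p, q, hX, hY, hQ⟩ := seqListForm_blowup h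
  constructor
  · rintro ⟨fs, hl, hi, hn⟩
    obtain ⟨m, n, rfl, hm, hn'⟩ : ∃ m n, fs = m ++ n ∧ m.length = p ∧ n.length = q :=
      ⟨fs.take p, fs.drop p, by simp, by simp; omega, by simp; omega⟩
    refine ⟨m ++ neighbourSum m n :: n, by simp; omega, fun u hu => hi u fun f hf => hu f ?_, ?_⟩
    · simp only [List.mem_append, List.mem_cons] at hf ⊢
      tauto
    · intro u
      have := hn u
      rw [List.map_append] at this
      rw [List.map_append, List.map_cons, hQ _ _ _ (by simpa) (by simpa), neighbourSum_map]
      simpa using this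
  · rintro ⟨fs, hl, hi, hn⟩
    obtain ⟨m, n', rfl, hm, hn'⟩ : ∃ m n, fs = m ++ n ∧ m.length = p ∧ n.length = q + 1 :=
      ⟨fs.take p, fs.drop p, by simp, by simp; omega, by simp; omega⟩
    obtain ⟨e, n, rfl⟩ := List.exists_cons_of_length_eq_add_one hn'
    have key : ∀ u, (e u - neighbourSum m n u) ^ 2 ≤ seqListForm X ((m ++ n).map (· u)) := by
      intro u
      have := hn u
      rw [List.map_append, List.map_cons, hQ _ _ _ (by simpa) (by simpa using hn'),
        neighbourSum_map, ← List.map_append] at this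
      linarith
    refine ⟨m ++ n, by simp at hn' ⊢; omega, fun u hu => ?_, fun u => (sq_nonneg _).trans (key u)⟩
    have h0 := key u
    rw [seqListForm_eq_zero X _ (List.forall_mem_map.2 hu)] at h0
    have h1 : neighbourSum m n u = 0 := by
      rw [← neighbourSum_map]
      have a1 : ∀ a ∈ m.map (· u), a = 0 :=
        List.forall_mem_map.2 fun f hf => hu f (List.mem_append_left _ hf)
      have a2 : ∀ a ∈ n.map (· u), a = 0 :=
        List.forall_mem_map.2 fun f hf => hu f (List.mem_append_right _ hf)
      have b1 : (m.map (· u)).getLastD 0 = 0 := by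
        rcases List.eq_nil_or_concat (m.map (· u)) with h | ⟨l, a, h⟩
        · simp [h]
        · rw [h] at a1 ⊢
          simpa using a1 a (by simp)
      have b2 : (n.map (· u)).headD 0 = 0 := by
        cases h : n.map (· u) with
        | nil => rfl
        | cons a l => exact a2 a (by simp [h])
      rw [neighbourSum, b1, b2, add_zero]
    have h2 : e u = 0 := by
      rw [h1, sub_zero] at h0
      exact pow_eq_zero_iff two_ne_zero |>.1 (le_antisymm h0 (sq_nonneg _))
    refine hi u fun f hf => ?_
    simp only [List.mem_append, List.mem_cons] at hf hu
    rcases hf with hf | rfl | hf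
    exacts [hu f (Or.inl hf), h2, hu f (Or.inr hf)]

theorem SeqEquiv.hasNonnegSpace_iff {X Y : List ℤ} (h : SeqEquiv X Y) (k : ℕ) :
    HasNonnegSpace X k ↔ HasNonnegSpace Y k := by
  induction h with
  | rel _ _ h => exact h.hasNonnegSpace_iff k
  | refl _ => rfl
  | symm _ _ _ ih => exact ih.symm
  | trans _ _ _ _ _ ih ih' => exact ih.trans ih'

theorem SeqEquiv.seqHodge_eq {X Y : List ℤ} (h : SeqEquiv X Y) : seqHodge X = seqHodge Y := by
  simp only [_root_.seqHodge_eq, h.hasNonnegSpace_iff]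

theorem IsAdmissible.seqListForm_le {A : List ℤ} (h : IsAdmissible A) (m : List ℝ)
    (hm : m.length = A.length) : seqListForm A m ≤ -(m.headD 0) ^ 2 := by
  induction A generalizing m with
  | nil =>
    obtain rfl := List.length_eq_zero_iff.1 hm
    simp [seqListForm]
  | cons x l ih =>
    obtain ⟨a, m, rfl⟩ := List.exists_cons_of_length_eq_add_one hm
    have h1 := ih (fun b hb => h b (List.mem_cons_of_mem _ hb)) m (by simpa using hm)
    have hx : (x : ℝ) ≤ -2 := by
      have : x ≤ -2 := by have := h x List.mem_cons_self; omega
      exact_mod_cast this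
    rw [seqListForm, List.headD_cons]
    nlinarith [sq_nonneg (a - m.headD 0), mul_nonneg (sq_nonneg a) (sub_nonneg.2 hx)]

theorem IsAdmissible.eq_zero_of_nonneg {A : List ℤ} (h : IsAdmissible A) (m : List ℝ)
    (hm : m.length = A.length) (h0 : 0 ≤ seqListForm A m) : ∀ a ∈ m, a = 0 := by
  induction A generalizing m with
  | nil =>
    obtain rfl := List.length_eq_zero_iff.1 hm
    simp
  | cons x l ih =>
    obtain ⟨a, m, rfl⟩ := List.exists_cons_of_length_eq_add_one hm
    have ha : a = 0 := by
      have := h.seqListForm_le _ hm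
      rw [List.headD_cons] at this
      exact pow_eq_zero_iff two_ne_zero |>.1 (le_antisymm (by linarith) (sq_nonneg a))
    subst ha
    rw [seqListForm, zero_mul, zero_add] at h0
    have := ih (fun b hb => h b (List.mem_cons_of_mem _ hb)) m (by simpa using hm) h0
    simpa using this

theorem hasNonnegSpace_zero (X : List ℤ) : HasNonnegSpace X 0 :=
  (hasNonnegSpace_iff X 0).2 ⟨⊥, by simp, by simp [seqForm]⟩

theorem IsAdmissible.isGreatest {A : List ℤ} (h : IsAdmissible A) :
    IsGreatest {k | HasNonnegSpace A k} 0 := by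
  refine ⟨hasNonnegSpace_zero A, ?_⟩
  rintro k ⟨fs, hl, hi, hn⟩
  by_contra! hk
  have : (Pi.single ⟨0, hk⟩ 1 : Fin k → ℝ) = 0 := hi _ fun f hf =>
    h.eq_zero_of_nonneg _ (by simpa using hl) (hn _) _ (List.mem_map_of_mem hf)
  simpa using congrFun this ⟨0, hk⟩

theorem isGreatest_singleton_zero : IsGreatest {k | HasNonnegSpace [0] k} 1 := by
  constructor
  · exact ⟨[LinearMap.proj 0], rfl, fun u hu => by ext i; simpa [Fin.fin_one_eq_zero i] using hu,
      fun u => by simp [seqListForm]⟩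
  · intro k hk
    obtain ⟨W, rfl, -⟩ := (hasNonnegSpace_iff _ _).1 hk
    simpa using Submodule.finrank_le W

theorem HasNonnegSpace.cons_zero_zero {X : List ℤ} {k : ℕ} (h : HasNonnegSpace X k) :
    HasNonnegSpace (0 :: 0 :: X) (k + 1) := by
  obtain ⟨fs, hl, hi, hn⟩ := h
  let t : (Fin (k + 1) → ℝ) →ₗ[ℝ] (Fin k → ℝ) := LinearMap.funLeft ℝ ℝ Fin.succ
  let b : Module.Dual ℝ (Fin (k + 1) → ℝ) := LinearMap.proj 0
  refine ⟨(b - fs.headD 0 ∘ₗ t) :: b :: fs.map (· ∘ₗ t), by simpa using hl, ?_, ?_⟩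
  · intro u hu
    have h0 : u 0 = 0 := hu b (by simp)
    have ht : t u = 0 := hi _ fun f hf => hu (f ∘ₗ t) (by simp; tauto)
    ext i
    refine Fin.cases h0 (fun i => ?_) i
    exact congrFun ht i
  · intro u
    have h1 : (fs.map (· (t u))).headD 0 = fs.headD 0 (t u) := by cases fs <;> simp
    have h2 : ((b - fs.headD 0 ∘ₗ t) :: b :: fs.map (· ∘ₗ t)).map (· u)
        = (b u - fs.headD 0 (t u)) :: b u :: fs.map (· (t u)) := by
      simp [Function.comp_def]
    rw [h2, seqListForm, seqListForm, List.headD_cons, h1]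
    have := hn (t u)
    push_cast
    nlinarith [sq_nonneg (b u)]

theorem exists_injective_into_ker {k : ℕ} (φ : Module.Dual ℝ (Fin (k + 1) → ℝ)) :
    ∃ s : (Fin k → ℝ) →ₗ[ℝ] (Fin (k + 1) → ℝ), Function.Injective s ∧ ∀ u, φ (s u) = 0 := by
  have h := φ.finrank_range_add_finrank_ker
  have h1 : Module.finrank ℝ (LinearMap.range φ) ≤ 1 := by
    simpa using Submodule.finrank_le (LinearMap.range φ)
  rw [Module.finrank_fin_fun] at h
  have h2 : k ≤ Module.finrank ℝ (LinearMap.ker φ) := by omega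
  let v : Fin k → LinearMap.ker φ := Module.finBasis ℝ (LinearMap.ker φ) ∘ Fin.castLE h2
  have hv : LinearIndependent ℝ v :=
    (Module.finBasis ℝ (LinearMap.ker φ)).linearIndependent.comp _ (Fin.castLE_injective h2)
  refine ⟨(LinearMap.ker φ).subtype ∘ₗ Fintype.linearCombination ℝ v, ?_, fun u => ?_⟩
  · exact (Submodule.injective_subtype _).comp
      (linearIndependent_iff_injective_fintypeLinearCombination.1 hv)
  · exact (Fintype.linearCombination ℝ v u).2

theorem HasNonnegSpace.of_cons_zero_zero {X : List ℤ} {k : ℕ}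
    (h : HasNonnegSpace (0 :: 0 :: X) (k + 1)) : HasNonnegSpace X k := by
  obtain ⟨fs, hl, hi, hn⟩ := h
  obtain ⟨a, fs, rfl⟩ := List.exists_cons_of_length_eq_add_one hl
  obtain ⟨b, fs, rfl⟩ := List.exists_cons_of_length_eq_add_one (by simpa using hl)
  obtain ⟨s, hs, hφ⟩ := exists_injective_into_ker (a + b + fs.headD 0)
  have key : ∀ u, 2 * b (s u) ^ 2 ≤ seqListForm X (fs.map (· (s u))) := by
    intro u
    have h1 : (fs.map (· (s u))).headD 0 = fs.headD 0 (s u) := by cases fs <;> simp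
    have h2 := hn (s u)
    have h3 := hφ u
    simp only [LinearMap.add_apply] at h3
    simp only [List.map_cons, seqListForm, List.headD_cons, h1, Int.cast_zero] at h2
    have h4 : a (s u) = -b (s u) - fs.headD 0 (s u) := by linarith
    rw [h4] at h2
    nlinarith
  refine ⟨fs.map (· ∘ₗ s), by simpa using hl, fun u hu => hs ?_, fun u => ?_⟩
  · rw [map_zero]
    have h0 : ∀ f ∈ fs, f (s u) = 0 := fun f hf => hu (f ∘ₗ s) (List.mem_map_of_mem hf)
    have h1 : b (s u) = 0 := by
      have := key u
      rw [seqListForm_eq_zero X _ (by simpa using h0)] at this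
      exact pow_eq_zero_iff two_ne_zero |>.1 (le_antisymm (by linarith) (sq_nonneg _))
    have h2 : fs.headD 0 (s u) = 0 := by
      cases fs with
      | nil => rfl
      | cons f fs => exact h0 f List.mem_cons_self
    have h3 : a (s u) = 0 := by
      have := hφ u
      rw [LinearMap.add_apply, LinearMap.add_apply, h1, h2] at this
      linarith
    exact hi _ (by simpa [h1, h3] using h0)
  · have := key u
    rw [List.map_map]
    exact (by positivity : (0 : ℝ) ≤ 2 * b (s u) ^ 2).trans this

theorem isGreatest_replicate_zero_append {X : List ℤ} {n : ℕ}
    (h : IsGreatest {k | HasNonnegSpace X k} n) (k : ℕ) :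
    IsGreatest {j | HasNonnegSpace (List.replicate (2 * k) 0 ++ X) j} (k + n) := by
  induction k with
  | zero => simpa using h
  | succ k ih =>
    have e : List.replicate (2 * (k + 1)) (0 : ℤ) ++ X
        = 0 :: 0 :: (List.replicate (2 * k) 0 ++ X) := by
      simp [Nat.mul_succ, List.replicate_succ]
    rw [e, Nat.add_right_comm]
    refine ⟨ih.1.cons_zero_zero, ?_⟩
    rintro (_ | j) hj
    · exact Nat.zero_le _
    · exact Nat.succ_le_succ (ih.2 (HasNonnegSpace.of_cons_zero_zero hj))

/-- **Uniqueness data of the canonical sequence.** Let `L ∈ ℤ*`, `n = hodge(L)`,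
`d = |det(L)|`, and let `(0^r, A)` (with `A` admissible, `r` even if `A ≠ ∅`) be a
canonical sequence equivalent to `L`. Then: (a) if `d = 0` then `r = 2n - 1` and
`A = ∅`; (b) if `d ≠ 0` then `r = 2n`, `det(A) = d`, and
`Subbar(A) = (-1)ⁿ · Subbar(L)` in `ℤ/dℤ × ℤ/dℤ`. -/
theorem canonical_sequence_uniqueness (L : List ℤ) (r : ℕ) (A : List ℤ)
    (hA : IsAdmissible A) (hr : A ≠ [] → Even r)
    (heq : SeqEquiv L (List.replicate r 0 ++ A)) :
    ((seqDet L).natAbs = 0 → r + 1 = 2 * seqHodge L ∧ A = []) ∧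
    ((seqDet L).natAbs ≠ 0 →
      r = 2 * seqHodge L ∧ seqDet A = ((seqDet L).natAbs : ℤ) ∧
      seqDet1 A ≡ (-1) ^ seqHodge L * seqDet1 L [ZMOD ((seqDet L).natAbs : ℤ)] ∧
      seqDet1 A.reverse ≡ (-1) ^ seqHodge L * seqDet1 L.reverse
        [ZMOD ((seqDet L).natAbs : ℤ)]) := by
  obtain ⟨hdet, hsub, hsub'⟩ := heq.seqDetCongr
  have hhodge := heq.seqHodge_eq
  rcases Nat.even_or_odd' r with ⟨k, rfl | rfl⟩
  · have hn : seqHodge L = k := by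
      rw [hhodge, seqHodge_eq]
      exact (isGreatest_replicate_zero_append hA.isGreatest k).csSup_eq
    have hpos : 0 < seqDet A := hA.seqDet1_lt_seqDet.1.trans_lt hA.seqDet1_lt_seqDet.2
    have hd : seqDet L = (-1) ^ k * seqDet A := by
      rw [hdet, ← (seqMat_col _).1, seqMat_replicate_two_mul_apply, (seqMat_col A).1]
    have hd1 : seqDet1 (List.replicate (2 * k) 0 ++ A) = (-1) ^ k * seqDet1 A := by
      rw [← (seqMat_col _).2, seqMat_replicate_two_mul_apply, (seqMat_col A).2]
    have hd2 : seqDet1 (List.replicate (2 * k) 0 ++ A).reverse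
        = (-1) ^ k * seqDet1 A.reverse := by
      have := seqMat_replicate_two_mul_apply k A 0 1
      rw [seqMat_zero_one, seqMat_zero_one] at this
      linarith
    have habs : ((seqDet L).natAbs : ℤ) = seqDet A := by
      rw [Int.natCast_natAbs, hd, abs_mul, abs_pow, abs_neg, abs_one, one_pow, one_mul,
        abs_of_pos hpos]
    have hsq : ((-1 : ℤ) ^ k) * (-1) ^ k = 1 := by
      rw [← mul_pow]
      simp
    have hcongr {a b : ℤ} (h : b ≡ (-1) ^ k * a [ZMOD seqDet L]) :
        a ≡ (-1) ^ k * b [ZMOD ((seqDet L).natAbs : ℤ)] := by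
      have h' := (h.mul_left ((-1) ^ k)).symm
      rw [← mul_assoc, hsq, one_mul] at h'
      exact h'.of_dvd (Int.natAbs_dvd.2 dvd_rfl)
    rw [hd1] at hsub
    rw [hd2] at hsub'
    refine ⟨fun h => ?_, fun _ => ?_⟩
    · rw [h] at habs
      simp only [Nat.cast_zero] at habs
      omega
    · rw [hn]
      exact ⟨rfl, habs.symm, hcongr hsub, hcongr hsub'⟩
  · have hA' : A = [] := by
      by_contra h
      have := hr h
      rw [Nat.even_iff] at this
      omega
    subst hA'
    have e : List.replicate (2 * k + 1) (0 : ℤ) ++ [] = List.replicate (2 * k) 0 ++ [0] := by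
      rw [List.append_nil, List.replicate_succ']
    rw [e] at hdet hhodge
    have hn : seqHodge L = k + 1 := by
      rw [hhodge, seqHodge_eq]
      exact (isGreatest_replicate_zero_append isGreatest_singleton_zero k).csSup_eq
    have hd : seqDet L = 0 := by
      rw [hdet, ← (seqMat_col _).1, seqMat_replicate_two_mul_apply, (seqMat_col _).1]
      simp [seqDet]
    refine ⟨fun _ => ⟨by omega, rfl⟩, fun h => absurd (by simp [hd]) h⟩
end

section
/- Every linear chain is equivalent, as a weighted graph, to [C] for some canonical sequence C. Moreover, if C and C' are canonical sequences, then [C] ~ [C'] if and only if C' = C or C' = C^t. -/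
/-- A weighted graph: a finite simple graph (vertices drawn from ℕ)
with an integer weight attached to each vertex. -/
structure WGraph where
  verts : Finset ℕ
  adj : ℕ → ℕ → Bool
  symm : ∀ u v, adj u v = adj v u
  irrefl : ∀ v, adj v v = false
  adj_mem : ∀ u v, adj u v = true → u ∈ verts ∧ v ∈ verts
  wt : ℕ → ℤ

/-- Isomorphism of weighted graphs. -/
def WGraph.Iso (G G' : WGraph) : Prop :=
  ∃ f : ℕ → ℕ, Set.BijOn f ↑G.verts ↑G'.verts ∧
    (∀ u ∈ G.verts, ∀ v ∈ G.verts, (G'.adj (f u) (f v) = G.adj u v)) ∧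
    (∀ v ∈ G.verts, G'.wt (f v) = G.wt v)

/-- Degree of a vertex: its number of neighbours. -/
def WGraph.deg (G : WGraph) (v : ℕ) : ℕ :=
  (G.verts.filter (fun u => G.adj v u)).card

/-- `G'` is the blowing-up of `G` at the vertex `v`, with created vertex `e`:
`e` gets weight `-1` and is joined to `v`, and the weight of `v` drops by `1`. -/
def IsVertexBlowup (G G' : WGraph) (v e : ℕ) : Prop :=
  v ∈ G.verts ∧ e ∉ G.verts ∧
  G'.verts = insert e G.verts ∧
  (∀ a b, G'.adj a b = true ↔
    (G.adj a b = true ∨ (a = e ∧ b = v) ∨ (a = v ∧ b = e))) ∧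
  G'.wt e = -1 ∧ G'.wt v = G.wt v - 1 ∧
  (∀ a ∈ G.verts, a ≠ v → G'.wt a = G.wt a)

/-- `G'` is the blowing-up of `G` at the edge `{v₁, v₂}`, with created vertex `e`:
the edge `{v₁,v₂}` is removed, `e` gets weight `-1` and is joined to `v₁` and `v₂`,
and the weights of `v₁`, `v₂` drop by `1`. -/
def IsEdgeBlowup (G G' : WGraph) (v₁ v₂ e : ℕ) : Prop :=
  G.adj v₁ v₂ = true ∧ e ∉ G.verts ∧
  G'.verts = insert e G.verts ∧
  (∀ a b, G'.adj a b = true ↔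
    ((G.adj a b = true ∧ ¬(a = v₁ ∧ b = v₂) ∧ ¬(a = v₂ ∧ b = v₁)) ∨
     (a = e ∧ (b = v₁ ∨ b = v₂)) ∨ (b = e ∧ (a = v₁ ∨ a = v₂)))) ∧
  G'.wt e = -1 ∧ G'.wt v₁ = G.wt v₁ - 1 ∧ G'.wt v₂ = G.wt v₂ - 1 ∧
  (∀ a ∈ G.verts, a ≠ v₁ → a ≠ v₂ → G'.wt a = G.wt a)

/-- `G'` is the free blowing-up of `G`, with created vertex `e`: the disjoint union
of `G` and an isolated vertex `e` of weight `-1`. -/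
def IsFreeBlowup (G G' : WGraph) (e : ℕ) : Prop :=
  e ∉ G.verts ∧ G'.verts = insert e G.verts ∧
  (∀ a b, G'.adj a b = G.adj a b) ∧
  G'.wt e = -1 ∧ (∀ a ∈ G.verts, G'.wt a = G.wt a)

/-- `G'` is a blowing-up of `G`. -/
def WBlowup (G G' : WGraph) : Prop :=
  (∃ v e, IsVertexBlowup G G' v e) ∨ (∃ v₁ v₂ e, IsEdgeBlowup G G' v₁ v₂ e) ∨
  (∃ e, IsFreeBlowup G G' e)

/-- Equivalence of weighted graphs: generated by blowings-up, blowings-down and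
isomorphisms of weighted graphs (graphs are considered up to isomorphism). -/
def WEquiv : WGraph → WGraph → Prop :=
  Relation.EqvGen (fun G G' => WBlowup G G' ∨ WGraph.Iso G G')

/-- The linear chain `[x₁, …, x_q]` associated with a sequence of integers:
consecutive vertices `0, 1, …, q-1` of weights `x₁, …, x_q`. -/
def chainGraph (X : List ℤ) : WGraph where
  verts := Finset.range X.length
  adj := fun i j => decide (i < X.length ∧ j < X.length ∧ (i + 1 = j ∨ j + 1 = i))
  symm := by intro u v; simp only [decide_eq_decide]; omega
  irrefl := by intro v; simp only [decide_eq_false_iff_not]; omega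
  adj_mem := by
    intro u v h
    simp only [decide_eq_true_eq] at h
    simp only [Finset.mem_range]
    omega
  wt := fun i => if h : i < X.length then X.get ⟨i, h⟩ else 0

/-- A weighted graph is a linear chain if it is isomorphic to `[X]` for some
finite sequence of integers `X`. -/
def IsLinearChain (G : WGraph) : Prop := ∃ X : List ℤ, WGraph.Iso G (chainGraph X)

/-- The transpose of a canonical sequence `C = (0^r, A)`, namely `C^t = (0^r, A⁻)`. -/
def canonTranspose (C : List ℤ) : List ℤ :=
  C.takeWhile (· == 0) ++ (C.dropWhile (· == 0)).reverse

/-! ### Moves on linear chains -/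

/-- Add `a` to the first term of a sequence, if there is one. -/
def addHead (a : ℤ) : List ℤ → List ℤ
  | [] => []
  | y :: R => (a + y) :: R

@[simp] lemma addHead_nil (a : ℤ) : addHead a [] = [] := rfl

@[simp] lemma addHead_cons (a y : ℤ) (R : List ℤ) : addHead a (y :: R) = (a + y) :: R := rfl

@[simp] lemma length_addHead (a : ℤ) (R : List ℤ) : (addHead a R).length = R.length := by
  cases R <;> rfl

@[simp] lemma addHead_zero (R : List ℤ) : addHead 0 R = R := by
  cases R <;> simp

@[simp] lemma addHead_addHead (a b : ℤ) (R : List ℤ) :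
    addHead a (addHead b R) = addHead (a + b) R := by
  cases R <;> simp [add_assoc]

/-- Elementary moves between sequences: blowing up the right-hand side of a vertex of a
chain, creating `[-1]` from the empty chain, and reading a chain backwards. -/
inductive ChainStep : List ℤ → List ℤ → Prop
  | blowup (L : List ℤ) (x : ℤ) (R : List ℤ) :
      ChainStep (L.reverse ++ x :: R) (L.reverse ++ (x - 1) :: (-1) :: addHead (-1) R)
  | free : ChainStep [] [-1]
  | reverse (X : List ℤ) : ChainStep X X.reverse

/-- The equivalence relation on sequences generated by the elementary moves. -/
def ChainRel : List ℤ → List ℤ → Prop := Relation.EqvGen ChainStep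

namespace ChainRel

lemma refl (X : List ℤ) : ChainRel X X := Relation.EqvGen.refl X

lemma symm {X Y : List ℤ} (h : ChainRel X Y) : ChainRel Y X := Relation.EqvGen.symm _ _ h

lemma trans {X Y Z : List ℤ} (h : ChainRel X Y) (h' : ChainRel Y Z) : ChainRel X Z :=
  Relation.EqvGen.trans _ _ _ h h'

lemma of_step {X Y : List ℤ} (h : ChainStep X Y) : ChainRel X Y := Relation.EqvGen.rel _ _ h

lemma reverse (X : List ℤ) : ChainRel X X.reverse := of_step (.reverse X)

lemma blowup_right (L : List ℤ) (x : ℤ) (R : List ℤ) :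
    ChainRel (L.reverse ++ x :: R) (L.reverse ++ (x - 1) :: (-1) :: addHead (-1) R) :=
  of_step (.blowup L x R)

lemma swap_sides {L R L' R' : List ℤ} (h : ChainRel (L.reverse ++ R) (L'.reverse ++ R')) :
    ChainRel (R.reverse ++ L) (R'.reverse ++ L') := by
  have h1 := ((reverse _).symm.trans h).trans (reverse _)
  simpa using h1

lemma blowup_left (L : List ℤ) (x : ℤ) (R : List ℤ) :
    ChainRel (L.reverse ++ x :: R) ((addHead (-1) L).reverse ++ (-1) :: (x - 1) :: R) := by
  have h := swap_sides (L := R) (L' := R) (blowup_right R x L)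
  simpa using h

lemma zero_shift_one (L R : List ℤ) :
    ChainRel (L.reverse ++ 0 :: R) ((addHead 1 L).reverse ++ 0 :: addHead (-1) R) := by
  have h1 := blowup_right L 0 R
  have h2 := blowup_left (addHead 1 L) 0 (addHead (-1) R)
  simp only [addHead_addHead] at h2
  norm_num at h1 h2
  exact h1.trans h2.symm

lemma zero_shift_nat (n : ℕ) (L R : List ℤ) :
    ChainRel (L.reverse ++ 0 :: R) ((addHead n L).reverse ++ 0 :: addHead (-n) R) := by
  induction n with
  | zero => simpa using refl _
  | succ n ih =>
    have h := zero_shift_one (addHead n L) (addHead (-n) R)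
    simp only [addHead_addHead] at h
    convert ih.trans h using 4 <;> push_cast <;> ring_nf

lemma zero_shift (a : ℤ) (L R : List ℤ) :
    ChainRel (L.reverse ++ 0 :: R) ((addHead a L).reverse ++ 0 :: addHead (-a) R) := by
  obtain ⟨n, rfl | rfl⟩ := a.eq_nat_or_neg
  · exact zero_shift_nat n L R
  · have h := zero_shift_nat n (addHead (-n) L) (addHead (- -n) R)
    simpa using h.symm

lemma zeros_to_front (L R : List ℤ) :
    ChainRel (L.reverse ++ 0 :: 0 :: R) (0 :: 0 :: (L.reverse ++ R)) := by
  induction L generalizing R with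
  | nil => simpa using refl _
  | cons l L ih =>
    have h := zero_shift (-l) (l :: L) (0 :: R)
    simp only [addHead_cons, List.reverse_cons, List.append_assoc, List.singleton_append,
      neg_add_cancel, neg_neg, add_zero] at h
    simpa using h.trans (ih (l :: R))

lemma cons_zero_zero {X Y : List ℤ} (h : ChainRel X Y) :
    ChainRel (0 :: 0 :: X) (0 :: 0 :: Y) := by
  induction h with
  | rel X Y h =>
    cases h with
    | blowup L x R =>
      have h := blowup_right (L ++ [0, 0]) x R
      rw [List.reverse_append] at h
      exact h
    | free =>
      have h1 := zero_shift 1 [] [1]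
      have h2 := blowup_right [0] 1 []
      norm_num at h1 h2
      exact h1.symm.trans h2
    | reverse =>
      have h2 := reverse (0 :: 0 :: X)
      have h3 := zeros_to_front X []
      rw [List.append_nil] at h3
      simp only [List.reverse_cons, List.append_assoc, List.singleton_append] at h2
      exact h2.trans h3
  | refl X => exact refl _
  | symm _ _ _ ih => exact ih.symm
  | trans _ _ _ _ _ ih ih' => exact ih.trans ih'

lemma blowup_right_iterate (n : ℕ) (L : List ℤ) (x : ℤ) (R : List ℤ) :
    ChainRel (L.reverse ++ x :: R) (L.reverse ++ (x - (n + 1)) :: (-1) ::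
      (List.replicate n (-2) ++ addHead (-1) R)) := by
  induction n with
  | zero => simpa using blowup_right L x R
  | succ n ih =>
    have h := blowup_right L (x - (n + 1)) (-1 :: (List.replicate n (-2) ++ addHead (-1) R))
    convert ih.trans h using 3
    · push_cast; ring
    · simp [List.replicate_succ]

lemma positive_reduce (n : ℕ) (L R : List ℤ) :
    ChainRel (L.reverse ++ ((n : ℤ) + 1) :: R) (0 :: 0 :: ((addHead (-1) L).reverse ++
      (List.replicate n (-2) ++ addHead (-1) R))) := by
  have h1 := blowup_right_iterate n L (n + 1) R
  have h2 := zero_shift (-1) L (-1 :: (List.replicate n (-2) ++ addHead (-1) R))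
  simp only [sub_self, addHead_cons, neg_neg, add_neg_cancel] at h1 h2
  exact h1.trans (h2.trans (zeros_to_front _ _))

lemma zero_reduce (L R : List ℤ) (y : ℤ) :
    ChainRel (L.reverse ++ 0 :: y :: R) (0 :: 0 :: ((addHead y L).reverse ++ R)) := by
  have h := zero_shift y L (y :: R)
  simp only [addHead_cons, neg_add_cancel] at h
  exact h.trans (zeros_to_front _ _)

lemma neg_one_reduce (L R : List ℤ) (l : ℤ) :
    ChainRel ((l :: L).reverse ++ (-1) :: R) ((addHead 1 (l :: L)).reverse ++ addHead 1 R) := by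
  have h := blowup_right L (1 + l) (addHead 1 R)
  simpa using h.symm

lemma zeros_append_reverse (k : ℕ) (A : List ℤ) :
    ChainRel (List.replicate (2 * k) 0 ++ A) (List.replicate (2 * k) 0 ++ A.reverse) := by
  induction k with
  | zero => simpa using reverse A
  | succ k ih => exact ih.cons_zero_zero

end ChainRel

/-! ### Reduction to canonical form -/

lemma IsCanonicalSeq.cons_zero_zero {C : List ℤ} (h : IsCanonicalSeq C) :
    IsCanonicalSeq (0 :: 0 :: C) := by
  obtain ⟨r, A, hA, hr, rfl⟩ := h
  exact ⟨r + 2, A, hA, fun h => (hr h).add even_two, rfl⟩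

lemma countP_addHead_neg_one_le (L : List ℤ) :
    (addHead (-1) L).countP (1 ≤ ·) ≤ L.countP (1 ≤ ·) := by
  cases L with
  | nil => simp
  | cons l L =>
    simp only [addHead_cons, List.countP_cons, decide_eq_true_eq]
    split_ifs <;> omega

lemma exists_canonical_chainRel (X : List ℤ) : ∃ C, IsCanonicalSeq C ∧ ChainRel X C := by
  by_cases hpos : ∃ x ∈ X, 1 ≤ x
  · obtain ⟨x, hx, h1⟩ := hpos
    obtain ⟨S, R, hX⟩ := List.append_of_mem hx
    obtain ⟨n, rfl⟩ : ∃ n : ℕ, x = n + 1 := ⟨(x - 1).toNat, by omega⟩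
    have h := ChainRel.positive_reduce n S.reverse R
    rw [List.reverse_reverse, ← hX] at h
    have hcount : ((addHead (-1) S.reverse).reverse ++ (List.replicate n (-2) ++
        addHead (-1) R)).countP (1 ≤ ·) < X.countP (1 ≤ ·) := by
      subst hX
      have hS := countP_addHead_neg_one_le S.reverse
      have hR := countP_addHead_neg_one_le R
      simp only [List.countP_reverse, List.countP_append, List.countP_cons,
        List.countP_replicate] at hS hR ⊢
      simp only [decide_eq_true_eq] at hS hR ⊢
      simp
      omega
    obtain ⟨C, hC, hrel⟩ := exists_canonical_chainRel
      ((addHead (-1) S.reverse).reverse ++ (List.replicate n (-2) ++ addHead (-1) R))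
    exact ⟨0 :: 0 :: C, hC.cons_zero_zero, h.trans hrel.cons_zero_zero⟩
  push Not at hpos
  have hle : ∀ Y : List ℤ, (∀ x ∈ Y, x < 1) → Y.countP (1 ≤ ·) = 0 := fun Y hY => by
    simpa [List.countP_eq_zero] using hY
  have hX0 := hle X hpos
  by_cases hzero : (0 : ℤ) ∈ X
  · obtain ⟨S, R, hX⟩ := List.append_of_mem hzero
    obtain ⟨L, y, T, hLT, hrel⟩ | hnil : (∃ L y T, (L.length + T.length + 2 = X.length ∧
        (∀ x ∈ L, x < 1) ∧ y < 1 ∧ ∀ x ∈ T, x < 1) ∧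
        ChainRel X (List.reverse L ++ 0 :: y :: T)) ∨ X = [0] := by
      rcases R with _ | ⟨y, R⟩
      · rcases hS : S.reverse with _ | ⟨y, T⟩
        · right; simpa [hX] using hS
        · left
          obtain rfl : S = (y :: T).reverse := by rw [← hS, List.reverse_reverse]
          subst hX
          refine ⟨[], y, T, ⟨by simp, by simp, hpos y (by simp), fun x hx => hpos x (by simp [hx])⟩, ?_⟩
          have h := ChainRel.reverse ((y :: T).reverse ++ [0])
          rw [List.reverse_append, List.reverse_reverse] at h
          exact h
      · left
        subst hX
        refine ⟨S.reverse, y, R, ⟨by simp; omega, fun x hx => hpos x (by simp_all),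
          hpos y (by simp), fun x hx => hpos x (by simp [hx])⟩, ?_⟩
        simpa using ChainRel.refl _
    · have hlt : ((addHead y L).reverse ++ T).countP (1 ≤ ·) = 0 := by
        apply hle
        rcases L with _ | ⟨l, L⟩
        · simpa using hLT.2.2.2
        · intro x hx
          simp only [addHead_cons, List.reverse_cons, List.mem_append, List.mem_reverse,
            List.mem_singleton, List.append_assoc] at hx
          have := hLT.2.1
          simp only [List.mem_cons, forall_eq_or_imp] at this
          rcases hx with hx | hx | hx
          · exact this.2 x hx
          · omega
          · exact hLT.2.2.2 x hx
      have hlen : ((addHead y L).reverse ++ T).length < X.length := by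
        simp at hLT ⊢; omega
      obtain ⟨C, hC, hrel'⟩ := exists_canonical_chainRel ((addHead y L).reverse ++ T)
      exact ⟨0 :: 0 :: C, hC.cons_zero_zero,
        hrel.trans ((ChainRel.zero_reduce L T y).trans hrel'.cons_zero_zero)⟩
    · rw [hnil]
      exact ⟨[0], ⟨1, [], by simp [IsAdmissible], by simp, rfl⟩, ChainRel.refl _⟩
  by_cases hone : (-1 : ℤ) ∈ X
  · obtain ⟨S, R, hX⟩ := List.append_of_mem hone
    have hneg : ∀ x ∈ X, x < 0 := fun x hx =>
      lt_of_le_of_ne (by have := hpos x hx; omega) (by rintro rfl; exact hzero hx)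
    obtain ⟨l, L, T, hLT, hrel⟩ | hnil : (∃ l L T,
        (L.length + T.length + 2 = X.length ∧
        (∀ x ∈ l :: L, x < 0) ∧ ∀ x ∈ T, x < 0) ∧
        ChainRel X ((l :: L).reverse ++ -1 :: T)) ∨ X = [-1] := by
      rcases hS : S.reverse with _ | ⟨l, L⟩
      · obtain rfl : S = [] := by simpa using hS
        rcases R with _ | ⟨y, R⟩
        · right; exact hX
        · left
          subst hX
          refine ⟨y, R, [], ⟨by simp, fun x hx => hneg x (by simp_all), by simp⟩, ?_⟩
          simpa using ChainRel.reverse (-1 :: y :: R)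
      · left
        obtain rfl : S = (l :: L).reverse := by rw [← hS, List.reverse_reverse]
        subst hX
        exact ⟨l, L, R, ⟨by simp; omega, fun x hx => hneg x (by simp at hx ⊢; tauto),
          fun x hx => hneg x (by simp [hx])⟩, ChainRel.refl _⟩
    · have hadd : ∀ Y : List ℤ, (∀ x ∈ Y, x < 0) → ∀ x ∈ addHead 1 Y, x < 1 := by
        rintro (_ | ⟨y, Y⟩) hY x hx
        · simp at hx
        · simp only [addHead_cons, List.mem_cons, forall_eq_or_imp] at hx hY
          rcases hx with rfl | hx
          · omega
          · have := hY.2 x hx; omega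
      have hlt : ((addHead 1 (l :: L)).reverse ++ addHead 1 T).countP (1 ≤ ·) = 0 := by
        apply hle
        intro x hx
        rw [List.mem_append, List.mem_reverse] at hx
        exact hx.elim (hadd _ hLT.2.1 x) (hadd _ hLT.2.2 x)
      have hlen : ((addHead 1 (l :: L)).reverse ++ addHead 1 T).length < X.length := by
        simp at hLT ⊢; omega
      obtain ⟨C, hC, hrel'⟩ :=
        exists_canonical_chainRel ((addHead 1 (l :: L)).reverse ++ addHead 1 T)
      exact ⟨C, hC, hrel.trans ((ChainRel.neg_one_reduce L T l).trans hrel')⟩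
    · rw [hnil]
      exact ⟨[], ⟨0, [], by simp [IsAdmissible], by simp, rfl⟩, (ChainRel.of_step .free).symm⟩
  refine ⟨X, ⟨0, X, fun a ha => ?_, by simp, by simp⟩, ChainRel.refl _⟩
  have h1 := hpos a ha
  have h2 : a ≠ 0 := by rintro rfl; exact hzero ha
  have h3 : a ≠ -1 := by rintro rfl; exact hone ha
  omega
termination_by (X.countP (1 ≤ ·), X.length)
decreasing_by
  · exact Prod.Lex.left _ _ hcount
  all_goals
    rw [hX0, hlt]
    exact Prod.Lex.right _ hlen

/-! ### Moves on chains are equivalences of weighted graphs -/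

lemma chainGraph_wt (X : List ℤ) (i : ℕ) : (chainGraph X).wt i = X.getD i 0 := by
  simp only [chainGraph, List.getD_eq_getElem?_getD]
  split_ifs with h <;> simp [h]

lemma chainGraph_adj (X : List ℤ) (i j : ℕ) : (chainGraph X).adj i j = true ↔
    i < X.length ∧ j < X.length ∧ (i + 1 = j ∨ j + 1 = i) := by
  simp [chainGraph]

lemma chainGraph_iso_reverse (X : List ℤ) :
    WGraph.Iso (chainGraph X) (chainGraph X.reverse) := by
  refine ⟨fun i => X.length - 1 - i, ⟨?_, ?_, ?_⟩, ?_, ?_⟩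
  · intro i hi
    simp only [chainGraph, Finset.coe_range, Set.mem_Iio, List.length_reverse] at hi ⊢
    omega
  · intro i hi j hj hij
    simp only [chainGraph, Finset.coe_range, Set.mem_Iio] at hi hj
    dsimp only at hij
    omega
  · intro i hi
    simp only [chainGraph, Finset.coe_range, Set.mem_Iio, List.length_reverse, Set.mem_image] at hi ⊢
    exact ⟨X.length - 1 - i, by omega, by omega⟩
  · intro i hi j hj
    simp only [chainGraph, Finset.mem_range] at hi hj
    rw [Bool.eq_iff_iff, chainGraph_adj, chainGraph_adj, List.length_reverse]
    dsimp only
    omega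
  · intro i hi
    simp only [chainGraph, Finset.mem_range] at hi
    rw [chainGraph_wt, chainGraph_wt, List.getD_eq_getElem _ _ hi,
      List.getD_eq_getElem _ _ (by simp; omega), List.getElem_reverse]
    congr 1
    dsimp only
    omega

lemma WBlowup.chainGraph_free : WBlowup (chainGraph []) (chainGraph [-1]) := by
  refine Or.inr (Or.inr ⟨0, by simp [chainGraph], by simp [chainGraph], ?_, ?_, by simp [chainGraph]⟩)
  · intro a b
    rw [Bool.eq_iff_iff, chainGraph_adj, chainGraph_adj]
    simp
    omega
  · simp [chainGraph]

/-- Positions of the vertices of a chain with `q` vertices after inserting a new vertex,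
labelled `q`, behind position `p`. -/
def insertPos (p q i : ℕ) : ℕ := if i ≤ p then i else if i = q then p + 1 else i + 1

/-- The chain `[Y]` on `q + 1` vertices with the vertex in position `p + 1` labelled `q`. -/
def relabelledChain (Y : List ℤ) (p q : ℕ) (hY : Y.length = q + 1) (_hp : p < q) : WGraph where
  verts := Finset.range (q + 1)
  adj := fun i j => (chainGraph Y).adj (insertPos p q i) (insertPos p q j)
  symm := fun _ _ => (chainGraph Y).symm _ _
  irrefl := fun _ => (chainGraph Y).irrefl _
  adj_mem := by
    intro u v h
    rw [chainGraph_adj] at h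
    simp only [Finset.mem_range]
    unfold insertPos at h
    split_ifs at h <;> omega
  wt := fun i => (chainGraph Y).wt (insertPos p q i)

lemma relabelledChain_iso (Y : List ℤ) (p q : ℕ) (hY : Y.length = q + 1) (hp : p < q) :
    WGraph.Iso (relabelledChain Y p q hY hp) (chainGraph Y) := by
  refine ⟨insertPos p q, ⟨?_, ?_, ?_⟩, fun _ _ _ _ => rfl, fun _ _ => rfl⟩
  · intro i hi
    simp only [relabelledChain, chainGraph, Finset.coe_range, Set.mem_Iio, insertPos] at hi ⊢
    split_ifs <;> omega
  · intro i hi j hj hij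
    simp only [relabelledChain, Finset.coe_range, Set.mem_Iio, insertPos] at hi hj hij
    split_ifs at hij <;> omega
  · intro i hi
    simp only [relabelledChain, chainGraph, Finset.coe_range, Set.mem_Iio, Set.mem_image, hY] at hi ⊢
    refine ⟨if i ≤ p then i else if i = p + 1 then q else i - 1, ?_, ?_⟩
    · split_ifs <;> omega
    · unfold insertPos
      split_ifs <;> omega

lemma WBlowup.relabelledChain_blowup (L : List ℤ) (x : ℤ) (R : List ℤ) :
    WBlowup (chainGraph (L ++ x :: R))
      (relabelledChain (L ++ (x - 1) :: (-1) :: addHead (-1) R) L.length (L ++ x :: R).length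
        (by simp; omega) (by simp)) := by
  rcases R with _ | ⟨y, R⟩
  · refine Or.inl ⟨L.length, L.length + 1, by simp [chainGraph], by simp [chainGraph], ?_, ?_, ?_, ?_, ?_⟩
    · ext i
      simp [chainGraph, relabelledChain]
      omega
    · intro a b
      simp only [relabelledChain, chainGraph_adj, insertPos, addHead_nil, List.length_append,
        List.length_cons, List.length_nil]
      split_ifs <;> omega
    · simp [relabelledChain, insertPos, chainGraph_wt, List.getD_eq_getElem?_getD]
    · simp [relabelledChain, insertPos, chainGraph_wt, List.getD_eq_getElem?_getD]
    · intro a ha hne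
      have ha' : a < L.length := by simp [chainGraph] at ha; omega
      simp only [relabelledChain, insertPos, chainGraph_wt, ha'.le, if_true]
      rw [List.getD_append _ _ _ _ ha', List.getD_append _ _ _ _ ha']
  · refine Or.inr (Or.inl ⟨L.length, L.length + 1, (L ++ x :: y :: R).length, ?_, by simp [chainGraph],
      ?_, ?_, ?_, ?_, ?_, ?_⟩)
    · simp [chainGraph_adj]
    · ext i
      simp [chainGraph, relabelledChain]
      omega
    · intro a b
      simp only [relabelledChain, chainGraph_adj, insertPos, addHead_cons, List.length_append,
        List.length_cons]
      split_ifs <;> omega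
    · simp [relabelledChain, insertPos, chainGraph_wt, List.getD_eq_getElem?_getD]
    · simp [relabelledChain, insertPos, chainGraph_wt, List.getD_eq_getElem?_getD]
    · have h1 : ¬ L.length + 1 ≤ L.length := by omega
      have h2 : L.length + 1 ≠ (L ++ x :: y :: R).length := by simp
      simp only [relabelledChain, insertPos, chainGraph_wt, h1, h2, if_false]
      rw [List.getD_append_right _ _ _ _ (by omega), List.getD_append_right _ _ _ _ (by omega),
        show L.length + 1 + 1 - L.length = 2 by omega, show L.length + 1 - L.length = 1 by omega]
      simp
      ring
    · intro a ha h1 h2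
      have ha' : a < L.length + (R.length + 2) := by simpa [chainGraph] using ha
      rcases lt_or_gt_of_ne h1 with h | h
      · simp only [relabelledChain, insertPos, chainGraph_wt, h.le, if_true]
        rw [List.getD_append _ _ _ _ h, List.getD_append _ _ _ _ h]
      · obtain ⟨j, rfl⟩ : ∃ j, a = L.length + (j + 2) := ⟨a - L.length - 2, by omega⟩
        have h3 : ¬ L.length + (j + 2) ≤ L.length := by omega
        have h4 : L.length + (j + 2) ≠ (L ++ x :: y :: R).length := by simp; omega
        simp only [relabelledChain, insertPos, chainGraph_wt, h3, h4, if_false]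
        rw [List.getD_append_right _ _ _ _ (by omega), List.getD_append_right _ _ _ _ (by omega),
          show L.length + (j + 2) + 1 - L.length = j + 3 by omega,
          show L.length + (j + 2) - L.length = j + 2 by omega]
        simp

lemma ChainRel.wEquiv {X Y : List ℤ} (h : ChainRel X Y) :
    WEquiv (chainGraph X) (chainGraph Y) := by
  induction h with
  | rel X Y h =>
    cases h with
    | blowup L x R =>
      exact Relation.EqvGen.trans _ _ _
        (Relation.EqvGen.rel _ _ (Or.inl (WBlowup.relabelledChain_blowup _ _ _)))
        (Relation.EqvGen.rel _ _ (Or.inr (relabelledChain_iso _ _ _ _ _)))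
    | free => exact Relation.EqvGen.rel _ _ (Or.inl WBlowup.chainGraph_free)
    | reverse => exact Relation.EqvGen.rel _ _ (Or.inr (chainGraph_iso_reverse _))
  | refl X => exact Relation.EqvGen.refl _
  | symm _ _ _ ih => exact Relation.EqvGen.symm _ _ ih
  | trans _ _ _ _ _ ih ih' => exact Relation.EqvGen.trans _ _ _ ih ih'

/-! ### Invariants of weighted graphs -/

namespace WGraph

/-- The intersection matrix of a weighted graph. -/
def mat (G : WGraph) (u v : ℕ) : ℤ := if u = v then G.wt u else if G.adj u v then 1 else 0

/-- Two minus the number of neighbours of `u`, computed from the intersection matrix. -/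
def euler (G : WGraph) (u : ℕ) : ℤ := 2 - (∑ v ∈ G.verts, G.mat u v - G.mat u u)

/-- The quadratic form of the intersection matrix. -/
def quad (G : WGraph) (x : ℕ → ℚ) : ℚ :=
  ∑ u ∈ G.verts, ∑ v ∈ G.verts, (G.mat u v : ℚ) * x u * x v

/-- The intersection form is positive definite on some `k`-dimensional space. -/
def HasPos (G : WGraph) (k : ℕ) : Prop :=
  ∃ T : (Fin k → ℚ) →ₗ[ℚ] (ℕ → ℚ), ∀ c, c ≠ 0 → 0 < G.quad (T c)

/-- Labellings of the vertices by elements of `M` that satisfy all relations given by the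
rows of the intersection matrix. -/
def Harmonic {M : Type} [AddCommGroup M] (G : WGraph) (φ : ℕ → M) : Prop :=
  ∀ u ∈ G.verts, ∑ v ∈ G.verts, G.mat u v • φ v = 0

open Classical in
/-- The functions `M → ℤ` which agree away from `0` with the formal sum
`∑ (2 - deg v) [φ v]` of some harmonic labelling `φ`. -/
def profile (G : WGraph) (M : Type) [AddCommGroup M] : Set (M → ℤ) :=
  {D | ∃ φ : ℕ → M, G.Harmonic φ ∧
    ∀ h, h ≠ 0 → D h = ∑ u ∈ G.verts, G.euler u * (if φ u = h then 1 else 0)}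

/-- `G'` arises from `G` by blowing up the set of vertices `S`, where `e` is the
created vertex. -/
structure BlowupAlong (G G' : WGraph) (S : Finset ℕ) (e : ℕ) : Prop where
  subset : S ⊆ G.verts
  not_mem : e ∉ G.verts
  verts_eq : G'.verts = insert e G.verts
  mat_old : ∀ u ∈ G.verts, ∀ v ∈ G.verts,
    G'.mat u v = G.mat u v - (if u ∈ S then 1 else 0) * (if v ∈ S then 1 else 0)
  mat_new : ∀ u ∈ G.verts, G'.mat e u = if u ∈ S then 1 else 0
  mat_self : G'.mat e e = -1
  card_le : S.card ≤ 2

lemma mat_comm (G : WGraph) (u v : ℕ) : G.mat u v = G.mat v u := by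
  unfold mat
  rw [G.symm u v]
  by_cases h : u = v
  · subst h; rfl
  · rw [if_neg h, if_neg (Ne.symm h)]

lemma _root_.WBlowup.exists_blowupAlong {G G' : WGraph} (h : WBlowup G G') :
    ∃ S e, BlowupAlong G G' S e := by
  have hnadj : ∀ {e}, e ∉ G.verts → ∀ a, ¬ G.adj e a = true ∧ ¬ G.adj a e = true :=
    fun he a => ⟨fun h => he (G.adj_mem _ _ h).1, fun h => he (G.adj_mem _ _ h).2⟩
  rcases h with ⟨w, e, hw, he, hverts, hadj, hwe, hww, hwo⟩ |
    ⟨v₁, v₂, e, h12, he, hverts, hadj, hwe, hw1, hw2, hwo⟩ | ⟨e, he, hverts, hadj, hwe, hwo⟩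
  · refine ⟨{w}, e, by simpa using hw, he, hverts, ?_, ?_, by simp [mat, hwe], by simp⟩
    · intro u hu v hv
      have hue : u ≠ e := by rintro rfl; exact he hu
      have hve : v ≠ e := by rintro rfl; exact he hv
      have key : G'.adj u v = G.adj u v := by
        rw [Bool.eq_iff_iff, hadj]; tauto
      simp only [mat, Finset.mem_singleton, key]
      by_cases huv : u = v
      · subst huv
        by_cases huw : u = w
        · subst huw; simp [hww]
        · simp [huw, hwo u hu huw]
      · by_cases huw : u = w
        · have : v ≠ w := by rintro rfl; exact huv huw
          simp [huv, this]
        · simp [huv, huw]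
    · intro u hu
      have hue : e ≠ u := by rintro rfl; exact he hu
      have key : G'.adj e u = true ↔ u = w := by
        rw [hadj]
        have := hnadj he u
        have : e ≠ w := by rintro rfl; exact he hw
        tauto
      simp only [mat, hue, if_false, Finset.mem_singleton, key]
  · obtain ⟨hv1, hv2⟩ := G.adj_mem _ _ h12
    have hne : v₁ ≠ v₂ := by rintro rfl; simp [G.irrefl] at h12
    have h21 : G.adj v₂ v₁ = true := by rw [G.symm]; exact h12
    refine ⟨{v₁, v₂}, e, ?_, he, hverts, ?_, ?_, by simp [mat, hwe], Finset.card_le_two⟩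
    · intro a ha
      simp only [Finset.mem_insert, Finset.mem_singleton] at ha
      rcases ha with rfl | rfl <;> assumption
    · intro u hu v hv
      have hue : u ≠ e := by rintro rfl; exact he hu
      have hve : v ≠ e := by rintro rfl; exact he hv
      have key : G'.adj u v = true ↔
          (G.adj u v = true ∧ ¬(u = v₁ ∧ v = v₂) ∧ ¬(u = v₂ ∧ v = v₁)) := by
        rw [hadj]; tauto
      simp only [mat, Finset.mem_singleton, Finset.mem_insert, key]
      by_cases huv : u = v
      · subst huv
        by_cases hu1 : u = v₁
        · subst hu1; simp [hw1]
        · by_cases hu2 : u = v₂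
          · subst hu2; simp [hw2]
          · simp [hu1, hu2, hwo u hu hu1 hu2]
      · by_cases hu1 : u = v₁
        · subst hu1
          by_cases h2 : v = v₂
          · subst h2; simp [huv, h12]
          · simp [huv, h2, hne, Ne.symm huv]
        · by_cases hu2 : u = v₂
          · subst hu2
            by_cases h2 : v = v₁
            · subst h2; simp [huv, h21]
            · simp [huv, h2, Ne.symm huv]
          · simp [huv, hu1, hu2]
    · intro u hu
      have hue : e ≠ u := by rintro rfl; exact he hu
      have key : G'.adj e u = true ↔ u = v₁ ∨ u = v₂ := by
        rw [hadj]
        have := hnadj he u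
        have : e ≠ v₁ := by rintro rfl; exact he hv1
        have : e ≠ v₂ := by rintro rfl; exact he hv2
        tauto
      simp only [mat, hue, if_false, Finset.mem_singleton, Finset.mem_insert, key]
  · refine ⟨∅, e, by simp, he, hverts, ?_, ?_, by simp [mat, hwe], by simp⟩
    · intro u hu v hv
      simp [mat, hadj, hwo u hu]
    · intro u hu
      have hue : e ≠ u := by rintro rfl; exact he hu
      simp [mat, hue, hadj, hnadj he u]

namespace BlowupAlong

variable {G G' : WGraph} {S : Finset ℕ} {e : ℕ}

lemma sum_indicator (H : BlowupAlong G G' S e) {M : Type} [AddCommGroup M] (φ : ℕ → M) :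
    ∑ v ∈ G.verts, (if v ∈ S then (1 : ℤ) else 0) • φ v = ∑ v ∈ S, φ v := by
  simp only [ite_smul, one_smul, zero_smul]
  rw [← Finset.sum_filter, Finset.filter_mem_eq_inter, Finset.inter_eq_right.mpr H.subset]

lemma row_new (H : BlowupAlong G G' S e) {M : Type} [AddCommGroup M] (φ : ℕ → M) :
    ∑ v ∈ G'.verts, G'.mat e v • φ v = ∑ v ∈ S, φ v - φ e := by
  rw [H.verts_eq, Finset.sum_insert H.not_mem, H.mat_self,
    Finset.sum_congr rfl (fun v hv => by rw [H.mat_new v hv]), H.sum_indicator]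
  simp [sub_eq_neg_add]

lemma row_old (H : BlowupAlong G G' S e) {M : Type} [AddCommGroup M] (φ : ℕ → M) {u : ℕ}
    (hu : u ∈ G.verts) :
    ∑ v ∈ G'.verts, G'.mat u v • φ v = ∑ v ∈ G.verts, G.mat u v • φ v -
      (if u ∈ S then (1 : ℤ) else 0) • (∑ v ∈ S, φ v - φ e) := by
  rw [H.verts_eq, Finset.sum_insert H.not_mem, mat_comm, H.mat_new u hu,
    Finset.sum_congr rfl (fun v hv => by rw [H.mat_old u hu v hv, sub_smul, mul_smul]),
    Finset.sum_sub_distrib, ← Finset.smul_sum, H.sum_indicator, smul_sub]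
  abel

lemma quad_eq (H : BlowupAlong G G' S e) (x : ℕ → ℚ) :
    G'.quad x = G.quad x - (∑ v ∈ S, x v - x e) ^ 2 := by
  have hquad : ∀ K : WGraph, K.quad x = ∑ u ∈ K.verts, x u * ∑ v ∈ K.verts, K.mat u v • x v := by
    intro K
    simp only [quad, Finset.mul_sum, zsmul_eq_mul]
    exact Finset.sum_congr rfl fun u _ => Finset.sum_congr rfl fun v _ => by ring
  rw [hquad, hquad]
  nth_rw 1 [H.verts_eq]
  rw [Finset.sum_insert H.not_mem, H.row_new,
    Finset.sum_congr (s₁ := G.verts) rfl (fun u hu => by rw [H.row_old x hu, mul_sub]),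
    Finset.sum_sub_distrib]
  have h1 : ∑ u ∈ G.verts, x u * ((if u ∈ S then (1 : ℤ) else 0) • (∑ v ∈ S, x v - x e)) =
      (∑ u ∈ S, x u) * (∑ v ∈ S, x v - x e) := by
    rw [← H.sum_indicator x, Finset.sum_mul]
    exact Finset.sum_congr rfl fun u _ => by simp only [zsmul_eq_mul]; ring
  rw [h1]
  ring

lemma hasPos_iff (H : BlowupAlong G G' S e) (k : ℕ) : G.HasPos k ↔ G'.HasPos k := by
  constructor
  · rintro ⟨T, hT⟩
    let E : (ℕ → ℚ) →ₗ[ℚ] (ℕ → ℚ) := LinearMap.pi fun i =>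
      if i = e then ∑ v ∈ S, LinearMap.proj v else LinearMap.proj i
    have hE : ∀ x, ∀ i, i ≠ e → E x i = x i := fun x i hi => by simp [E, hi]
    have hEe : ∀ x, E x e = ∑ v ∈ S, x v := fun x => by simp [E]
    refine ⟨E ∘ₗ T, fun c hc => ?_⟩
    have hmem : ∀ v ∈ G.verts, E (T c) v = T c v := fun v hv =>
      hE _ _ (by rintro rfl; exact H.not_mem hv)
    rw [LinearMap.comp_apply, H.quad_eq, hEe,
      Finset.sum_congr rfl fun v hv => hmem v (H.subset hv)]
    have : G.quad (E (T c)) = G.quad (T c) :=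
      Finset.sum_congr rfl fun u hu => Finset.sum_congr rfl fun v hv => by
        rw [hmem u hu, hmem v hv]
    simpa [this] using hT c hc
  · rintro ⟨T, hT⟩
    refine ⟨T, fun c hc => ?_⟩
    have := hT c hc
    rw [H.quad_eq] at this
    nlinarith [sq_nonneg (∑ v ∈ S, T c v - T c e)]

lemma harmonic_iff (H : BlowupAlong G G' S e) {M : Type} [AddCommGroup M] (φ : ℕ → M) :
    G'.Harmonic φ ↔ G.Harmonic φ ∧ φ e = ∑ v ∈ S, φ v := by
  have hnew : G'.Harmonic φ → φ e = ∑ v ∈ S, φ v := fun h => by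
    have h1 := h e (by rw [H.verts_eq]; exact Finset.mem_insert_self _ _)
    rw [H.row_new, sub_eq_zero] at h1
    exact h1.symm
  have hold : φ e = ∑ v ∈ S, φ v → ∀ u ∈ G.verts,
      ∑ v ∈ G'.verts, G'.mat u v • φ v = ∑ v ∈ G.verts, G.mat u v • φ v := fun h u hu => by
    rw [H.row_old φ hu, h]; simp
  constructor
  · intro h
    refine ⟨fun u hu => ?_, hnew h⟩
    rw [← hold (hnew h) u hu]
    exact h u (by rw [H.verts_eq]; exact Finset.mem_insert_of_mem hu)
  · rintro ⟨h, he⟩ u hu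
    rw [H.verts_eq, Finset.mem_insert] at hu
    rcases hu with rfl | hu
    · rw [H.row_new, he, sub_self]
    · rw [hold he u hu, h u hu]

lemma euler_new (H : BlowupAlong G G' S e) : G'.euler e = 2 - S.card := by
  have h := H.row_new (fun _ => (1 : ℤ))
  simp only [smul_eq_mul, mul_one, Finset.sum_const, nsmul_eq_mul] at h
  rw [euler, h, H.mat_self]
  simp

lemma euler_old (H : BlowupAlong G G' S e) {u : ℕ} (hu : u ∈ G.verts) :
    G'.euler u = G.euler u - (if u ∈ S then 1 else 0) * (2 - S.card) := by
  have h := H.row_old (fun _ => (1 : ℤ)) hu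
  simp only [smul_eq_mul, mul_one, Finset.sum_const, nsmul_eq_mul] at h
  rw [euler, euler, h, H.mat_old u hu u hu]
  split_ifs <;> ring

open Classical in
lemma euler_sum_eq (H : BlowupAlong G G' S e) {M : Type} [AddCommGroup M] (φ : ℕ → M)
    (he : φ e = ∑ v ∈ S, φ v) (h : M) (h0 : h ≠ 0) :
    ∑ u ∈ G'.verts, G'.euler u * (if φ u = h then 1 else 0) =
      ∑ u ∈ G.verts, G.euler u * (if φ u = h then 1 else 0) := by
  rw [H.verts_eq, Finset.sum_insert H.not_mem, H.euler_new,
    Finset.sum_congr rfl (fun u hu => by rw [H.euler_old hu, sub_mul]), Finset.sum_sub_distrib]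
  have h1 : ∑ u ∈ G.verts, (if u ∈ S then (1 : ℤ) else 0) * (2 - S.card) *
      (if φ u = h then 1 else 0) = (2 - S.card) * ∑ u ∈ S, (if φ u = h then 1 else 0) := by
    rw [← H.sum_indicator, Finset.mul_sum]
    exact Finset.sum_congr rfl fun u _ => by simp only [smul_eq_mul]; ring
  rw [h1]
  have h2 : (2 - (S.card : ℤ)) * (if φ e = h then 1 else 0) =
      (2 - S.card) * ∑ u ∈ S, (if φ u = h then 1 else 0) := by
    have hc := H.card_le
    interval_cases hS : S.card
    · rw [Finset.card_eq_zero] at hS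
      subst hS
      simp [he, h0.symm]
    · rw [Finset.card_eq_one] at hS
      obtain ⟨w, rfl⟩ := hS
      rw [he, Finset.sum_singleton, Finset.sum_singleton]
    · simp
  rw [h2]
  ring

lemma profile_eq (H : BlowupAlong G G' S e) (M : Type) [AddCommGroup M] :
    G'.profile M = G.profile M := by
  classical
  ext D
  constructor
  · rintro ⟨φ, hφ, hD⟩
    obtain ⟨h1, h2⟩ := (H.harmonic_iff φ).mp hφ
    exact ⟨φ, h1, fun h h0 => by rw [hD h h0, H.euler_sum_eq φ h2 h h0]⟩
  · rintro ⟨φ, hφ, hD⟩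
    have hne : ∀ v ∈ G.verts, Function.update φ e (∑ v ∈ S, φ v) v = φ v := fun v hv =>
      Function.update_of_ne (by rintro rfl; exact H.not_mem hv) _ _
    have he : Function.update φ e (∑ v ∈ S, φ v) e =
        ∑ v ∈ S, Function.update φ e (∑ v ∈ S, φ v) v := by
      rw [Function.update_self]
      exact Finset.sum_congr rfl fun v hv => (hne v (H.subset hv)).symm
    refine ⟨Function.update φ e (∑ v ∈ S, φ v), (H.harmonic_iff _).mpr ⟨fun u hu => ?_, he⟩,
      fun h h0 => ?_⟩
    · rw [← hφ u hu]
      exact Finset.sum_congr rfl fun v hv => by rw [hne v hv]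
    · rw [hD h h0, H.euler_sum_eq _ he h h0]
      exact Finset.sum_congr rfl fun v hv => by rw [hne v hv]

end BlowupAlong

lemma Iso.symm {G G' : WGraph} (h : Iso G G') : Iso G' G := by
  obtain ⟨f, hf, hadj, hwt⟩ := h
  have hinv := hf.invOn_invFunOn
  have hg := (Set.bijOn_comm hinv).mpr hf
  refine ⟨Function.invFunOn f G.verts, hg, fun u hu v hv => ?_, fun v hv => ?_⟩
  · rw [← hadj _ (hg.mapsTo hu) _ (hg.mapsTo hv), hinv.2 hu, hinv.2 hv]
  · rw [← hwt _ (hg.mapsTo hv), hinv.2 hv]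

lemma Iso.exists_mat {G G' : WGraph} (h : Iso G G') :
    ∃ f : ℕ → ℕ, Set.InjOn f G.verts ∧ G'.verts = G.verts.image f ∧
      ∀ u ∈ G.verts, ∀ v ∈ G.verts, G'.mat (f u) (f v) = G.mat u v := by
  obtain ⟨f, hf, hadj, hwt⟩ := h
  refine ⟨f, hf.injOn, ?_, fun u hu v hv => ?_⟩
  · apply Finset.coe_injective
    rw [Finset.coe_image, hf.image_eq]
  · simp only [mat, hadj u hu v hv, hwt u hu, hf.injOn.eq_iff hu hv]

lemma Iso.hasPos {G G' : WGraph} (h : Iso G G') {k : ℕ} (hk : G'.HasPos k) : G.HasPos k := by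
  obtain ⟨f, hf, hv, hmat⟩ := h.exists_mat
  obtain ⟨T, hT⟩ := hk
  refine ⟨LinearMap.funLeft ℚ ℚ f ∘ₗ T, fun c hc => ?_⟩
  convert hT c hc using 1
  simp only [quad, hv, Finset.sum_image hf]
  exact Finset.sum_congr rfl fun u hu => Finset.sum_congr rfl fun v hv => by
    rw [hmat u hu v hv]; rfl

lemma Iso.profile_subset {G G' : WGraph} (h : Iso G G') (M : Type) [AddCommGroup M] :
    G'.profile M ⊆ G.profile M := by
  classical
  obtain ⟨f, hf, hv, hmat⟩ := h.exists_mat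
  have heuler : ∀ u ∈ G.verts, G'.euler (f u) = G.euler u := fun u hu => by
    rw [euler, euler, hv, Finset.sum_image hf, hmat u hu u hu,
      Finset.sum_congr rfl fun v hv => hmat u hu v hv]
  rintro D ⟨φ, hφ, hD⟩
  refine ⟨φ ∘ f, fun u hu => ?_, fun h h0 => ?_⟩
  · have h1 := hφ (f u) (by rw [hv]; exact Finset.mem_image_of_mem f hu)
    rw [hv, Finset.sum_image hf] at h1
    rw [← h1]
    exact Finset.sum_congr rfl fun v hv => by rw [hmat u hu v hv]; rfl
  · rw [hD h h0, hv, Finset.sum_image hf]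
    exact Finset.sum_congr rfl fun u hu => by rw [heuler u hu]; rfl

lemma _root_.WEquiv.hasPos_iff {G G' : WGraph} (h : WEquiv G G') (k : ℕ) :
    G.HasPos k ↔ G'.HasPos k := by
  induction h with
  | rel G G' h =>
    rcases h with h | h
    · obtain ⟨S, e, H⟩ := h.exists_blowupAlong
      exact H.hasPos_iff k
    · exact ⟨h.symm.hasPos, h.hasPos⟩
  | refl => exact Iff.rfl
  | symm _ _ _ ih => exact ih.symm
  | trans _ _ _ _ _ ih ih' => exact ih.trans ih'

lemma _root_.WEquiv.profile_eq {G G' : WGraph} (h : WEquiv G G') (M : Type) [AddCommGroup M] :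
    G.profile M = G'.profile M := by
  induction h with
  | rel G G' h =>
    rcases h with h | h
    · obtain ⟨S, e, H⟩ := h.exists_blowupAlong
      exact (H.profile_eq M).symm
    · exact Set.Subset.antisymm (h.symm.profile_subset M) (h.profile_subset M)
  | refl => rfl
  | symm _ _ _ ih => exact ih.symm
  | trans _ _ _ _ _ ih ih' => exact ih.trans ih'

end WGraph

/-! ### The intersection form of a linear chain -/

lemma chainGraph_row {M : Type} [AddCommGroup M] (X : List ℤ) (g : ℕ → M) {u : ℕ}
    (hu : u < X.length) :
    ∑ v ∈ (chainGraph X).verts, (chainGraph X).mat u v • g v =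
      X.getD u 0 • g u + (if 0 < u then g (u - 1) else 0) +
        (if u + 1 < X.length then g (u + 1) else 0) := by
  have key : ∀ v ∈ Finset.range X.length, (chainGraph X).mat u v • g v =
      (if v = u then X.getD u 0 • g u else 0) +
        (if v = u - 1 then (if 0 < u then g (u - 1) else 0) else 0) +
        (if v = u + 1 then g (u + 1) else 0) := by
    intro v hv
    rw [Finset.mem_range] at hv
    simp only [WGraph.mat, chainGraph_adj, chainGraph_wt, hu, hv, true_and]
    by_cases h1 : u = v
    · subst h1
      have h2 : u = u - 1 → ¬ 0 < u := by omega
      by_cases h3 : u = u - 1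
      · simp [← h3, h2 h3]
      · simp [h3]
    · by_cases h2 : v = u + 1
      · subst h2
        have : u + 1 ≠ u - 1 := by omega
        simp [this]
      · by_cases h3 : v = u - 1
        · subst h3
          have h4 : 0 < u := by omega
          have h5 : u - 1 + 1 = u := by omega
          have h6 : u - 1 ≠ u := by omega
          have h7 : u ≠ u - 1 := by omega
          have h8 : u - 1 ≠ u + 1 := by omega
          simp [h4, h5, h6, h7, h8]
        · have h5 : v + 1 ≠ u := by omega
          have h6 : u + 1 ≠ v := by omega
          simp [h1, h2, h3, h5, h6, Ne.symm h1]
  change ∑ v ∈ Finset.range X.length, _ = _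
  rw [Finset.sum_congr rfl key, Finset.sum_add_distrib, Finset.sum_add_distrib,
    Finset.sum_ite_eq', Finset.sum_ite_eq', Finset.sum_ite_eq']
  have h : u - 1 < X.length := by omega
  simp only [Finset.mem_range, hu, h, if_true]

lemma chainGraph_euler (X : List ℤ) {u : ℕ} (hu : u < X.length) :
    (chainGraph X).euler u = (if u = 0 then 1 else 0) + (if u = X.length - 1 then 1 else 0) := by
  have h := chainGraph_row X (fun _ => (1 : ℤ)) hu
  simp only [smul_eq_mul, mul_one] at h
  have h' : (chainGraph X).mat u u = X.getD u 0 := by simp [WGraph.mat, chainGraph_wt]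
  rw [WGraph.euler, h, h']
  split_ifs <;> omega

lemma chainGraph_quad (X : List ℤ) (n : ℕ) (hn : X.length = n + 1) (x : ℕ → ℚ) :
    (chainGraph X).quad x = ∑ u ∈ Finset.range (n + 1), (X.getD u 0 : ℚ) * x u ^ 2 +
      2 * ∑ u ∈ Finset.range n, x u * x (u + 1) := by
  have h1 : (chainGraph X).quad x = ∑ u ∈ Finset.range (n + 1), ((X.getD u 0 : ℚ) * x u ^ 2 +
      (if 0 < u then x u * x (u - 1) else 0) + (if u < n then x u * x (u + 1) else 0)) := by
    have : (chainGraph X).verts = Finset.range (n + 1) := by simp [chainGraph, hn]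
    rw [WGraph.quad]
    refine Finset.sum_congr this fun u hu => ?_
    rw [Finset.mem_range] at hu
    have h := congrArg (x u * ·) (chainGraph_row X x (hu.trans_eq hn.symm))
    simp only [Finset.mul_sum, zsmul_eq_mul, hn, add_lt_add_iff_right] at h
    rw [← Finset.sum_congr rfl fun v _ => show x u * (((chainGraph X).mat u v : ℚ) * x v) = _ by ring,
      h]
    split_ifs <;> ring
  rw [h1, Finset.sum_add_distrib, Finset.sum_add_distrib, Finset.sum_range_succ' (fun u =>
    if 0 < u then x u * x (u - 1) else 0), Finset.sum_range_succ (fun u =>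
    if u < n then x u * x (u + 1) else 0)]
  have h2 : ∑ u ∈ Finset.range n, (if u < n then x u * x (u + 1) else 0) =
      ∑ u ∈ Finset.range n, x u * x (u + 1) :=
    Finset.sum_congr rfl fun u hu => if_pos (Finset.mem_range.mp hu)
  have h3 : ∑ u ∈ Finset.range n, (if 0 < u + 1 then x (u + 1) * x (u + 1 - 1) else 0) =
      ∑ u ∈ Finset.range n, x u * x (u + 1) :=
    Finset.sum_congr rfl fun u hu => by simp [mul_comm]
  rw [h2, h3]
  simp
  ring

lemma getD_zeros_append_of_lt {r : ℕ} (A : List ℤ) {u : ℕ} (hu : u < r) :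
    (List.replicate r 0 ++ A).getD u 0 = 0 := by
  rw [List.getD_append _ _ _ _ (by simpa using hu), List.getD_replicate _ hu]

lemma sum_neg_two_add_le (y : ℕ → ℚ) (n : ℕ) :
    ∑ u ∈ Finset.range (n + 1), -2 * y u ^ 2 +
      ∑ u ∈ Finset.range n, (y u ^ 2 + y (u + 1) ^ 2) ≤ - y n ^ 2 := by
  induction n with
  | zero => simp; nlinarith [sq_nonneg (y 0)]
  | succ n ih =>
    rw [Finset.sum_range_succ, Finset.sum_range_succ (fun u => y u ^ 2 + y (u + 1) ^ 2)]
    linarith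

lemma chainGraph_quad_nonpos {r : ℕ} {A : List ℤ} (hA : IsAdmissible A) (hr : A ≠ [] → Even r)
    (x : ℕ → ℚ) (hx : ∀ i < r / 2, x (2 * i + 1) = 0) :
    (chainGraph (List.replicate r 0 ++ A)).quad x ≤ 0 := by
  rcases hn : (List.replicate r 0 ++ A).length with _ | n
  · rw [List.length_eq_zero_iff.mp hn]
    simp [WGraph.quad, chainGraph]
  rw [chainGraph_quad _ n hn]
  set y : ℕ → ℚ := fun i => if i < r then 0 else x i with hy
  have hlen : r + A.length = n + 1 := by simpa using hn
  have hdiag : ∀ u ∈ Finset.range (n + 1),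
      ((List.replicate r 0 ++ A).getD u 0 : ℚ) * x u ^ 2 ≤ -2 * y u ^ 2 := by
    intro u hu
    rw [Finset.mem_range] at hu
    by_cases hur : u < r
    · rw [getD_zeros_append_of_lt A hur]
      simp [hy, hur]
    · rw [List.getD_append_right _ _ _ _ (by simpa using hur), List.length_replicate]
      have hu' : u - r < A.length := by omega
      rw [List.getD_eq_getElem _ _ hu']
      have h2 : A[u - r] ≤ -2 := by have := hA _ (List.getElem_mem hu'); omega
      have h3 : (A[u - r] : ℚ) ≤ -2 := by exact_mod_cast h2
      simp only [hy, hur, if_false]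
      exact mul_le_mul_of_nonneg_right h3 (sq_nonneg _)
  have hoff : ∀ u ∈ Finset.range n, 2 * (x u * x (u + 1)) ≤ y u ^ 2 + y (u + 1) ^ 2 := by
    intro u hu
    rw [Finset.mem_range] at hu
    by_cases hur : u < r
    · have hzero : x u * x (u + 1) = 0 := by
        rcases Nat.even_or_odd' u with ⟨i, rfl | rfl⟩
        · rw [hx i ?_, mul_zero]
          rcases A with _ | ⟨a, A⟩
          · simp at hlen; omega
          · obtain ⟨m, rfl⟩ := hr (by simp)
            omega
        · rw [hx i (by omega), zero_mul]
      rw [hzero, mul_zero]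
      positivity
    · have h1 : ¬ u + 1 < r := by omega
      simp only [hy, hur, h1, if_false]
      nlinarith [sq_nonneg (x u - x (u + 1))]
  have h1 := Finset.sum_le_sum hdiag
  have h2 := Finset.sum_le_sum hoff
  have h3 := sum_neg_two_add_le y n
  rw [← Finset.mul_sum] at h2
  nlinarith [sq_nonneg (y n)]

lemma le_half_of_hasPos {r k : ℕ} {A : List ℤ} (hA : IsAdmissible A) (hr : A ≠ [] → Even r)
    (h : (chainGraph (List.replicate r 0 ++ A)).HasPos k) : k ≤ r / 2 := by
  obtain ⟨T, hT⟩ := h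
  by_contra! hk
  let P : (ℕ → ℚ) →ₗ[ℚ] (Fin (r / 2) → ℚ) := LinearMap.funLeft ℚ ℚ fun i => 2 * (i : ℕ) + 1
  have hker : LinearMap.ker (P ∘ₗ T) ≠ ⊥ :=
    LinearMap.ker_ne_bot_of_finrank_lt (by simpa using hk)
  obtain ⟨c, hc, hc0⟩ := (Submodule.ne_bot_iff _).mp hker
  refine absurd (hT c hc0) (not_lt.mpr (chainGraph_quad_nonpos hA hr _ fun i hi => ?_))
  exact congrFun (LinearMap.mem_ker.mp hc) ⟨i, hi⟩

lemma two_mul_sum_doubled (d : ℕ → ℚ) (j : ℕ) :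
    2 * ∑ u ∈ Finset.range (2 * j + 1), d (u / 2) * d ((u + 1) / 2) =
      d 0 ^ 2 + ∑ i ∈ Finset.range j, (d i + d (i + 1)) ^ 2 + d j ^ 2 := by
  induction j with
  | zero => simp; ring
  | succ j ih =>
    rw [show 2 * (j + 1) + 1 = 2 * j + 1 + 1 + 1 by ring, Finset.sum_range_succ _ (2 * j + 1 + 1),
      Finset.sum_range_succ _ (2 * j + 1), Finset.sum_range_succ _ j, mul_add, mul_add, ih]
    rw [show (2 * j + 1) / 2 = j by omega, show (2 * j + 1 + 1) / 2 = j + 1 by omega,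
      show (2 * j + 1 + 1 + 1) / 2 = j + 1 by omega]
    ring

lemma hasPos_half (r : ℕ) (A : List ℤ) :
    (chainGraph (List.replicate r 0 ++ A)).HasPos (r / 2) := by
  let T : (Fin (r / 2) → ℚ) →ₗ[ℚ] (ℕ → ℚ) := LinearMap.pi fun i =>
    if h : i / 2 < r / 2 then LinearMap.proj ⟨i / 2, h⟩ else 0
  refine ⟨T, fun c hc => ?_⟩
  set d : ℕ → ℚ := fun i => if h : i < r / 2 then c ⟨i, h⟩ else 0 with hd
  have hTc : ∀ i, T c i = d (i / 2) := fun i => by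
    simp only [T, hd, LinearMap.pi_apply]
    split_ifs <;> simp
  have hd0 : ∀ i, r / 2 ≤ i → d i = 0 := fun i hi => by simp [hd, hi]
  obtain hk | ⟨j, hk⟩ : r / 2 = 0 ∨ ∃ j, r / 2 = j + 1 := by
    rcases r / 2 with _ | j
    · exact Or.inl rfl
    · exact Or.inr ⟨j, rfl⟩
  · refine absurd (funext fun i => ?_) hc
    have := i.2
    omega
  obtain ⟨n, hn⟩ : ∃ n, (List.replicate r 0 ++ A).length = n + 1 :=
    ⟨r + A.length - 1, by simp; omega⟩
  have hrn : 2 * j + 1 ≤ n := by simp at hn; omega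
  rw [chainGraph_quad _ n hn, Finset.sum_eq_zero, zero_add]
  · simp only [hTc]
    rw [← Finset.sum_subset (Finset.range_mono hrn), two_mul_sum_doubled]
    · by_contra! hle
      have hs : 0 ≤ ∑ i ∈ Finset.range j, (d i + d (i + 1)) ^ 2 :=
        Finset.sum_nonneg fun i _ => sq_nonneg _
      have h0 : d 0 = 0 := by nlinarith [sq_nonneg (d 0), sq_nonneg (d j)]
      have hs0 : ∑ i ∈ Finset.range j, (d i + d (i + 1)) ^ 2 = 0 := by
        nlinarith [sq_nonneg (d 0), sq_nonneg (d j)]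
      rw [Finset.sum_eq_zero_iff_of_nonneg fun i _ => sq_nonneg _] at hs0
      have hall : ∀ i, i ≤ j → d i = 0 := by
        intro i
        induction i with
        | zero => exact fun _ => h0
        | succ i ih =>
          intro hi
          have := pow_eq_zero_iff (two_ne_zero) |>.mp (hs0 i (Finset.mem_range.mpr hi))
          rw [ih (by omega)] at this
          simpa using this
      refine hc (funext fun i => ?_)
      have := hall i (by omega)
      simpa [hd] using this
    · intro u _ hu
      rw [Finset.mem_range] at hu
      rw [hd0 ((u + 1) / 2) (by omega), mul_zero]
  · intro u _
    by_cases hu : u < r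
    · rw [getD_zeros_append_of_lt A hu]; simp
    · rw [hTc, hd0 (u / 2) (by omega)]; simp

/-! ### Harmonic labellings of a linear chain -/

/-- Numerator and denominator of the negative continued fraction of a sequence: the
determinants of minus the intersection matrices of the chain and of its tail. -/
def contFrac : List ℤ → ℤ × ℤ
  | [] => (1, 0)
  | x :: X => (-x * (contFrac X).1 - (contFrac X).2, (contFrac X).1)

lemma contFrac_drop (X : List ℤ) {i : ℕ} (hi : i < X.length) :
    contFrac (X.drop i) = (-X.getD i 0 * (contFrac (X.drop (i + 1))).1 -
      (contFrac (X.drop (i + 1))).2, (contFrac (X.drop (i + 1))).1) := by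
  rw [List.drop_eq_getElem_cons hi, contFrac, List.getD_eq_getElem _ _ hi]

section Harmonic

variable {M : Type} [AddCommGroup M]

/-- The labelling of a chain obtained by extending the label `b` of its last vertex. -/
def chainLabel (X : List ℤ) (b : M) (i : ℕ) : M := (contFrac (X.drop i)).2 • b

lemma chainLabel_length (X : List ℤ) (b : M) : chainLabel X b X.length = 0 := by
  simp [chainLabel, contFrac]

lemma chainLabel_last (X : List ℤ) (b : M) (hX : 0 < X.length) :
    chainLabel X b (X.length - 1) = b := by
  rw [chainLabel, contFrac_drop X (by omega), Nat.sub_add_cancel hX]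
  simp [contFrac]

lemma contFrac_fst_smul (X : List ℤ) (b : M) {i : ℕ} (hi : i < X.length) :
    (contFrac (X.drop i)).1 • b + X.getD i 0 • chainLabel X b i + chainLabel X b (i + 1) = 0 := by
  rw [chainLabel, chainLabel, contFrac_drop X hi]
  simp only [← mul_smul, ← add_smul]
  convert zero_smul ℤ b using 2
  ring

lemma chainLabel_recurrence (X : List ℤ) (b : M) {i : ℕ} (hi : i + 1 < X.length) :
    chainLabel X b i + X.getD (i + 1) 0 • chainLabel X b (i + 1) + chainLabel X b (i + 2) = 0 := by
  rw [← contFrac_fst_smul X b hi]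
  congr 2
  rw [chainLabel, contFrac_drop X (by omega)]

lemma harmonic_chain_iff (X : List ℤ) (φ : ℕ → M) :
    (chainGraph X).Harmonic φ ↔
      (∀ i < X.length, φ i = chainLabel X (φ (X.length - 1)) i) ∧
      (X ≠ [] → (contFrac X).1 • φ (X.length - 1) = 0) := by
  set b := φ (X.length - 1) with hb
  have hrow : (chainGraph X).Harmonic φ ↔ ∀ u < X.length, X.getD u 0 • φ u +
      (if 0 < u then φ (u - 1) else 0) + (if u + 1 < X.length then φ (u + 1) else 0) = 0 := by
    have hmem : ∀ u, u ∈ (chainGraph X).verts ↔ u < X.length := fun u => by simp [chainGraph]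
    simp only [WGraph.Harmonic, hmem]
    exact forall₂_congr fun u hu => by rw [chainGraph_row X φ hu]
  rw [hrow]
  have hnext : (∀ i < X.length, φ i = chainLabel X b i) → ∀ u < X.length,
      (if u + 1 < X.length then φ (u + 1) else 0) = chainLabel X b (u + 1) := by
    intro h u hu
    split_ifs with hu'
    · exact h _ hu'
    · rw [show u + 1 = X.length by omega, chainLabel_length]
  constructor
  · intro h
    have hlab : ∀ j, j < X.length → φ (X.length - 1 - j) = chainLabel X b (X.length - 1 - j) ∧
        (if X.length - j < X.length then φ (X.length - j) else 0) =
          chainLabel X b (X.length - j) := by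
      intro j
      induction j with
      | zero =>
        intro hj
        exact ⟨by rw [Nat.sub_zero, chainLabel_last X b hj], by simp [chainLabel_length]⟩
      | succ j ih =>
        intro hj
        obtain ⟨h1, h2⟩ := ih (by omega)
        obtain ⟨i, hi⟩ : ∃ i, X.length = i + 2 + j := ⟨X.length - j - 2, by omega⟩
        have e1 : X.length - 1 - j = i + 1 := by omega
        have e2 : X.length - j = i + 2 := by omega
        have e3 : X.length - 1 - (j + 1) = i := by omega
        have e4 : X.length - (j + 1) = i + 1 := by omega
        rw [e1] at h1
        rw [e2] at h2
        have h3 := h (i + 1) (by omega)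
        rw [show i + 1 + 1 = i + 2 by ring, h2, h1, if_pos (by omega), Nat.add_sub_cancel] at h3
        have h4 := chainLabel_recurrence X b (i := i) (by omega)
        rw [e3, e4, if_pos (by omega)]
        refine ⟨?_, h1⟩
        rw [add_comm (X.getD _ _ • _)] at h3
        exact add_right_cancel (add_right_cancel (h3.trans h4.symm))
    have hlab' : ∀ i < X.length, φ i = chainLabel X b i := fun i hi => by
      have := (hlab (X.length - 1 - i) (by omega)).1
      rwa [show X.length - 1 - (X.length - 1 - i) = i by omega] at this
    refine ⟨hlab', fun hX => ?_⟩
    have hpos : 0 < X.length := List.length_pos_of_ne_nil hX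
    have h0 := h 0 hpos
    rw [hnext hlab' 0 hpos, hlab' 0 hpos] at h0
    have h1 := contFrac_fst_smul X b hpos
    rw [List.drop_zero] at h1
    simp only [lt_irrefl, if_false, add_zero] at h0
    rw [add_assoc, h0, add_zero] at h1
    exact h1
  · rintro ⟨hlab, hN⟩ u hu
    rw [hnext hlab u hu, hlab u hu]
    rcases u with _ | u
    · have h1 := contFrac_fst_smul X b hu
      rw [List.drop_zero, hN (List.ne_nil_of_length_pos hu), zero_add] at h1
      simpa using h1
    · rw [if_pos (by omega), Nat.add_sub_cancel, hlab u (by omega),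
        add_comm (X.getD _ _ • _)]
      exact chainLabel_recurrence X b hu

open Classical in
lemma mem_profile_chain_iff (X : List ℤ) (D : M → ℤ) :
    D ∈ (chainGraph X).profile M ↔ ∃ b : M, (contFrac X).1 • b = 0 ∧ ∀ h, h ≠ 0 →
      D h = (if (contFrac X).2 • b = h then 1 else 0) + (if b = h then 1 else 0) := by
  rcases Nat.eq_zero_or_pos X.length with hX | hX
  · obtain rfl := List.length_eq_zero_iff.mp hX
    constructor
    · rintro ⟨φ, -, hD⟩
      refine ⟨0, by simp, fun h h0 => ?_⟩
      rw [hD h h0]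
      simp [chainGraph, h0.symm]
    · rintro ⟨b, hb, hD⟩
      obtain rfl : b = 0 := by simpa [contFrac] using hb
      refine ⟨0, by simp [WGraph.Harmonic], fun h h0 => ?_⟩
      rw [hD h h0]
      simp [chainGraph, h0.symm]
  have hne : X ≠ [] := List.ne_nil_of_length_pos hX
  have hsum : ∀ (φ : ℕ → M) (h : M), ∑ u ∈ (chainGraph X).verts, (chainGraph X).euler u *
      (if φ u = h then 1 else 0) =
      (if φ 0 = h then 1 else 0) + (if φ (X.length - 1) = h then 1 else 0) := by
    intro φ h
    change ∑ u ∈ Finset.range X.length, _ = _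
    rw [Finset.sum_congr rfl fun u hu => by
      rw [chainGraph_euler X (Finset.mem_range.mp hu), add_mul, ite_mul, ite_mul, one_mul, zero_mul],
      Finset.sum_add_distrib, Finset.sum_ite_eq', Finset.sum_ite_eq']
    have h1 : X.length - 1 < X.length := by omega
    simp only [Finset.mem_range, hX, h1, if_true]
  constructor
  · rintro ⟨φ, hφ, hD⟩
    obtain ⟨h1, h2⟩ := (harmonic_chain_iff X φ).mp hφ
    refine ⟨φ (X.length - 1), h2 hne, fun h h0 => ?_⟩
    rw [hD h h0, hsum, h1 0 hX]
    rfl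
  · rintro ⟨b, hb, hD⟩
    have hlast := chainLabel_last X b hX
    refine ⟨chainLabel X b, (harmonic_chain_iff X _).mpr ⟨fun i _ => by rw [hlast],
      fun _ => by rw [hlast]; exact hb⟩, fun h h0 => ?_⟩
    rw [hD h h0, hsum, hlast]
    rfl

end Harmonic

/-! ### Continued fractions of admissible sequences -/

lemma contFrac_zeros_append (k : ℕ) (A : List ℤ) :
    contFrac (List.replicate (2 * k) 0 ++ A) =
      ((-1) ^ k * (contFrac A).1, (-1) ^ k * (contFrac A).2) := by
  induction k with
  | zero => simp
  | succ k ih =>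
    rw [show 2 * (k + 1) = 2 * k + 1 + 1 by ring, List.replicate_succ, List.replicate_succ,
      List.cons_append, List.cons_append, contFrac, contFrac, ih]
    ext <;> simp <;> ring

lemma contFrac_odd_zeros (k : ℕ) :
    contFrac (List.replicate (2 * k + 1) 0) = (0, (-1) ^ k) := by
  rw [List.replicate_add, contFrac_zeros_append]
  simp [contFrac]

lemma IsAdmissible.of_cons {x : ℤ} {A : List ℤ} (h : IsAdmissible (x :: A)) :
    x < -1 ∧ IsAdmissible A :=
  ⟨h x (by simp), fun a ha => h a (by simp [ha])⟩

lemma IsAdmissible.contFrac_bounds {A : List ℤ} (h : IsAdmissible A) :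
    0 ≤ (contFrac A).2 ∧ (contFrac A).2 < (contFrac A).1 := by
  induction A with
  | nil => simp [contFrac]
  | cons x A ih =>
    obtain ⟨hx, hA⟩ := h.of_cons
    obtain ⟨h1, h2⟩ := ih hA
    simp only [contFrac]
    constructor <;> nlinarith

lemma IsAdmissible.contFrac_injective {A B : List ℤ} (hA : IsAdmissible A) (hB : IsAdmissible B)
    (h : contFrac A = contFrac B) : A = B := by
  induction A generalizing B with
  | nil =>
    rcases B with _ | ⟨y, B⟩
    · rfl
    · have := hB.of_cons.2.contFrac_bounds
      simp only [contFrac, Prod.mk.injEq] at h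
      omega
  | cons x A ih =>
    obtain ⟨-, hA'⟩ := hA.of_cons
    have hAb := hA'.contFrac_bounds
    rcases B with _ | ⟨y, B⟩
    · simp only [contFrac, Prod.mk.injEq] at h
      omega
    obtain ⟨-, hB'⟩ := hB.of_cons
    have hBb := hB'.contFrac_bounds
    simp only [contFrac, Prod.mk.injEq] at h
    obtain ⟨h1, h2⟩ := h
    rw [← h2] at h1 hBb
    have hxy : x = y := by
      rcases lt_trichotomy x y with hlt | heq | hlt
      · nlinarith
      · exact heq
      · nlinarith
    subst hxy
    rw [ih hA' hB' (Prod.ext h2 (by linarith))]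

/-- The product of the elementary matrices of the negative continued fraction. -/
def contMat : List ℤ → Matrix (Fin 2) (Fin 2) ℤ
  | [] => 1
  | x :: X => !![-x, -1; 1, 0] * contMat X

lemma contMat_append (X Y : List ℤ) : contMat (X ++ Y) = contMat X * contMat Y := by
  induction X with
  | nil => simp [contMat]
  | cons x X ih => rw [List.cons_append, contMat, contMat, ih, mul_assoc]

lemma contMat_fst_col (X : List ℤ) :
    contMat X 0 0 = (contFrac X).1 ∧ contMat X 1 0 = (contFrac X).2 := by
  induction X with
  | nil => simp [contMat, contFrac]
  | cons x X ih =>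
    simp [contMat, contFrac, Matrix.mul_apply, Fin.sum_univ_two, ih.1, ih.2]
    ring

lemma contMat_det (X : List ℤ) : (contMat X).det = 1 := by
  induction X with
  | nil => simp [contMat]
  | cons x X ih => rw [contMat, Matrix.det_mul, ih, Matrix.det_fin_two_of]; ring

lemma contMat_reverse (X : List ℤ) :
    contMat X.reverse = !![contMat X 0 0, -contMat X 1 0; -contMat X 0 1, contMat X 1 1] := by
  induction X with
  | nil => ext i j; fin_cases i <;> fin_cases j <;> simp [contMat]
  | cons x X ih =>
    rw [List.reverse_cons, contMat_append, ih]
    ext i j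
    fin_cases i <;> fin_cases j <;>
      simp [contMat, Matrix.mul_apply, Fin.sum_univ_two] <;> ring

lemma contFrac_reverse_fst (X : List ℤ) : (contFrac X.reverse).1 = (contFrac X).1 := by
  rw [← (contMat_fst_col X.reverse).1, contMat_reverse, ← (contMat_fst_col X).1]
  simp

lemma contFrac_dvd_mul_reverse (X : List ℤ) :
    (contFrac X).1 ∣ (contFrac X).2 * (contFrac X.reverse).2 - 1 := by
  have h := contMat_det X
  rw [Matrix.det_fin_two] at h
  rw [← (contMat_fst_col X.reverse).2, contMat_reverse, ← (contMat_fst_col X).1,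
    ← (contMat_fst_col X).2]
  refine ⟨-contMat X 1 1, ?_⟩
  simp
  linarith

lemma contFrac_isCoprime (X : List ℤ) : IsCoprime (contFrac X).1 (contFrac X).2 := by
  obtain ⟨c, hc⟩ := contFrac_dvd_mul_reverse X
  exact ⟨-c, (contFrac X.reverse).2, by linarith⟩

lemma IsAdmissible.reverse {A : List ℤ} (h : IsAdmissible A) : IsAdmissible A.reverse :=
  fun a ha => h a (by simpa using ha)

/-! ### Classification of canonical sequences -/

lemma dvd_of_profile_subset {X Y : List ℤ} {n u n' u' s : ℤ} (hs : s * s = 1) (hn : 1 ≤ n)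
    (hX : contFrac X = (s * n, s * u)) (hY : contFrac Y = (s * n', s * u'))
    (h : (chainGraph X).profile (ZMod n.toNat) ⊆ (chainGraph Y).profile (ZMod n.toNat)) :
    n ∣ n' ∧ (n ∣ u' - u ∨ n ∣ u * u' - 1) := by
  classical
  obtain rfl | hn2 := hn.eq_or_lt
  · simp
  have hcop : IsCoprime n u := by
    have := contFrac_isCoprime X
    rw [hX] at this
    exact (IsCoprime.of_mul_left_right this).of_mul_right_right
  have hcast : ∀ a : ℤ, (a : ZMod n.toNat) = 0 ↔ n ∣ a := fun a => by
    rw [ZMod.intCast_zmod_eq_zero_iff_dvd, Int.toNat_of_nonneg (by omega)]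
  have hn0 : (n : ZMod n.toNat) = 0 := (hcast n).mpr dvd_rfl
  have hss : (s : ZMod n.toNat) * s = 1 := by rw [← Int.cast_mul, hs, Int.cast_one]
  have h10 : (1 : ZMod n.toNat) ≠ 0 := by
    intro h1
    have := Int.le_of_dvd one_pos ((hcast 1).mp (by simpa using h1))
    omega
  have hsu0 : (s : ZMod n.toNat) * u ≠ 0 := by
    intro h0
    obtain ⟨a, b, hab⟩ := hcop
    have := congrArg (Int.cast : ℤ → ZMod n.toNat) hab
    push_cast at this
    rw [hn0, mul_zero, zero_add] at this
    refine h10 ?_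
    linear_combination (-1 : ZMod n.toNat) * this - b * u * hss + b * s * h0
  obtain ⟨b, hb, hD⟩ := (mem_profile_chain_iff Y _).mp (h ((mem_profile_chain_iff X fun g =>
    (if (s : ZMod n.toNat) * u = g then 1 else 0) + (if 1 = g then 1 else 0)).mpr
      ⟨1, by rw [hX]; simp [hn0], fun g _ => by rw [hX]; simp⟩))
  rw [hY] at hb hD
  simp only [zsmul_eq_mul, Int.cast_mul] at hb hD
  have hD1 := hD 1 h10
  have hDu := hD _ hsu0
  rw [if_pos rfl] at hD1 hDu
  rw [← hcast, ← hcast, ← hcast]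
  push_cast
  by_cases hb1 : b = 1
  · subst hb1
    refine ⟨by linear_combination s * hb - n' * hss, Or.inl ?_⟩
    have : (s : ZMod n.toNat) * u' = s * u := by
      by_contra hne
      rw [mul_one, if_neg hne] at hDu
      split_ifs at hDu <;> omega
    linear_combination s * this - (u' - u) * hss
  · rw [if_neg hb1] at hD1
    have hub : (s : ZMod n.toNat) * u' * b = 1 := by
      by_contra hne
      rw [if_neg hne] at hD1
      split_ifs at hD1 <;> omega
    have hsu1 : (s : ZMod n.toNat) * u ≠ 1 := by
      intro h1
      rw [if_pos h1, if_pos hub] at hD1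
      omega
    have hbu : b = s * u := by
      by_contra hne
      rw [if_neg hne, hub, if_neg hsu1.symm] at hDu
      omega
    subst hbu
    exact ⟨by linear_combination u' * hb - n' * hub, Or.inr (by
      linear_combination hub - u * u' * hss)⟩

lemma IsAdmissible.eq_or_eq_reverse_of_wEquiv {A B : List ℤ} (hA : IsAdmissible A)
    (hB : IsAdmissible B) {k : ℕ} (h : WEquiv (chainGraph (List.replicate (2 * k) 0 ++ A))
      (chainGraph (List.replicate (2 * k) 0 ++ B))) : B = A ∨ B = A.reverse := by
  have hs : ((-1) ^ k * (-1) ^ k : ℤ) = 1 := by rw [← mul_pow]; simp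
  have hAb := hA.contFrac_bounds
  have hBb := hB.contFrac_bounds
  have hRb := hA.reverse.contFrac_bounds
  have hR := contFrac_reverse_fst A
  obtain ⟨hdvd, hu⟩ := dvd_of_profile_subset hs (by omega) (contFrac_zeros_append k A)
    (contFrac_zeros_append k B) (h.profile_eq _).subset
  obtain ⟨hdvd', -⟩ := dvd_of_profile_subset hs (by omega) (contFrac_zeros_append k B)
    (contFrac_zeros_append k A) (h.profile_eq _).superset
  have hn : (contFrac A).1 = (contFrac B).1 :=
    Int.dvd_antisymm (by omega) (by omega) hdvd hdvd'
  have hsmall : ∀ a b : ℤ, (contFrac A).1 ∣ b - a → 0 ≤ a → a < (contFrac A).1 → 0 ≤ b →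
      b < (contFrac A).1 → a = b := fun a b hab h1 h2 h3 h4 => by
    have := (Int.modEq_iff_dvd.mpr hab).eq
    rwa [Int.emod_eq_of_lt h1 h2, Int.emod_eq_of_lt h3 h4] at this
  rcases hu with hu | hu
  · left
    refine hB.contFrac_injective hA (Prod.ext hn.symm (Eq.symm ?_))
    exact hsmall _ _ hu (by omega) (by omega) (by omega) (by omega)
  · right
    refine hB.contFrac_injective hA.reverse (Prod.ext (by omega) (Eq.symm ?_))
    refine hsmall _ _ ?_ (by omega) (by omega) (by omega) (by omega)
    refine (contFrac_isCoprime A).dvd_of_dvd_mul_left ?_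
    have := dvd_sub hu (contFrac_dvd_mul_reverse A)
    rwa [sub_sub_sub_cancel_right, ← mul_sub] at this

lemma IsAdmissible.not_profile_odd_zeros_subset {B : List ℤ} (hB : IsAdmissible B) (k l : ℕ) :
    ¬ (chainGraph (List.replicate (2 * k + 1) 0)).profile ℤ ⊆
      (chainGraph (List.replicate (2 * l) 0 ++ B)).profile ℤ := by
  classical
  intro h
  have hBb := hB.contFrac_bounds
  obtain ⟨b, hb, hD⟩ := (mem_profile_chain_iff _ _).mp (h ((mem_profile_chain_iff _ fun g =>
    (if (-1) ^ k = g then 1 else 0) + (if 1 = g then 1 else 0)).mpr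
      ⟨1, by simp [contFrac_odd_zeros], fun g _ => by simp [contFrac_odd_zeros]⟩))
  have hb0 : b = 0 := by
    have hne : (contFrac B).1 ≠ 0 := by omega
    simpa [contFrac_zeros_append, hne] using hb
  have hD1 := hD 1 one_ne_zero
  rw [hb0] at hD1
  simp only [smul_zero, zero_ne_one, if_false, if_true] at hD1
  split_ifs at hD1
  all_goals omega

lemma IsAdmissible.canonTranspose {A : List ℤ} (hA : IsAdmissible A) (r : ℕ) :
    canonTranspose (List.replicate r 0 ++ A) = List.replicate r 0 ++ A.reverse := by
  have hz : ∀ a ∈ List.replicate r (0 : ℤ), (a == 0) = true := fun a ha => by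
    simp [List.eq_of_mem_replicate ha]
  rw [_root_.canonTranspose, List.takeWhile_append_of_pos hz, List.dropWhile_append_of_pos hz]
  rcases A with _ | ⟨a, A⟩
  · simp
  · have := hA.of_cons.1
    have ha : (a == 0) = false := by simpa using (by omega : a ≠ 0)
    simp [ha]

lemma IsCanonicalSeq.eq_or_eq_canonTranspose {C C' : List ℤ} (hC : IsCanonicalSeq C)
    (hC' : IsCanonicalSeq C') (h : WEquiv (chainGraph C) (chainGraph C')) :
    C' = C ∨ C' = canonTranspose C := by
  obtain ⟨r, A, hA, hr, rfl⟩ := hC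
  obtain ⟨r', B, hB, hr', rfl⟩ := hC'
  have hhalf : r / 2 = r' / 2 := le_antisymm
    (le_half_of_hasPos hB hr' ((h.hasPos_iff _).mp (hasPos_half r A)))
    (le_half_of_hasPos hA hr ((h.hasPos_iff _).mpr (hasPos_half r' B)))
  have hodd : ∀ {m : ℕ} {D : List ℤ}, (D ≠ [] → Even m) → Odd m → D = [] := fun h hm =>
    by_contra fun hD => Nat.not_even_iff_odd.mpr hm (h hD)
  rw [hA.canonTranspose]
  rcases Nat.even_or_odd' r with ⟨k, rfl | rfl⟩ <;> rcases Nat.even_or_odd' r' with ⟨l, rfl | rfl⟩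
  · obtain rfl : k = l := by omega
    rcases hA.eq_or_eq_reverse_of_wEquiv hB h with rfl | rfl <;> simp
  · obtain rfl := hodd hr' ⟨l, rfl⟩
    rw [List.append_nil] at h
    exact absurd (h.profile_eq ℤ).superset (hA.not_profile_odd_zeros_subset l k)
  · obtain rfl := hodd hr ⟨k, rfl⟩
    rw [List.append_nil] at h
    exact absurd (h.profile_eq ℤ).subset (hB.not_profile_odd_zeros_subset k l)
  · obtain rfl := hodd hr ⟨k, rfl⟩
    obtain rfl := hodd hr' ⟨l, rfl⟩
    obtain rfl : k = l := by omega
    simp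

lemma IsCanonicalSeq.wEquiv_canonTranspose {C : List ℤ} (hC : IsCanonicalSeq C) :
    WEquiv (chainGraph C) (chainGraph (canonTranspose C)) := by
  obtain ⟨r, A, hA, hr, rfl⟩ := hC
  rw [hA.canonTranspose]
  rcases eq_or_ne A [] with rfl | hne
  · exact Relation.EqvGen.refl _
  · obtain ⟨k, rfl⟩ := hr hne
    rw [← two_mul]
    exact (ChainRel.zeros_append_reverse k A).wEquiv

/-- **Classification of linear chains.** Every linear chain is equivalent to `[C]` for
some canonical sequence `C`; and for canonical sequences `C`, `C'`,
`[C] ~ [C']` iff `C' = C` or `C' = C^t`. -/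
theorem linear_chain_classification :
    (∀ G : WGraph, IsLinearChain G →
      ∃ C : List ℤ, IsCanonicalSeq C ∧ WEquiv G (chainGraph C)) ∧
    (∀ C C' : List ℤ, IsCanonicalSeq C → IsCanonicalSeq C' →
      (WEquiv (chainGraph C) (chainGraph C') ↔ C' = C ∨ C' = canonTranspose C)) := by
  refine ⟨fun G ⟨X, hX⟩ => ?_, fun C C' hC hC' => ⟨hC.eq_or_eq_canonTranspose hC', ?_⟩⟩
  · obtain ⟨C, hC, hXC⟩ := exists_canonical_chainRel X
    exact ⟨C, hC, .trans _ _ _ (.rel _ _ (Or.inr hX)) hXC.wEquiv⟩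
  · rintro (rfl | rfl)
    · exact .refl _
    · exact hC.wEquiv_canonTranspose
end
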